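/- arXiv:0904.2401 — 8 statements merged into one kernel-verified Lean document; each statement's English description precedes it below -/
import Mathlib

section
/- Let F be a field and let G be a matrix over F with column blocks C_1,…,C_m and row blocks R_1,…,R_{m'}. Given nonnegative integers ℓ(1),…,ℓ(m), ℓ'(1),…,ℓ'(m') with Σ_j ℓ(j) = Σ_k ℓ'(k) = R, the matrix G supports the flow d = (ℓ(1),…,ℓ(m); ℓ'(1),…,ℓ'(m')) if and only if for all U ⊆ {1,…,m} and all W ⊆ {1,…,m'} one has rank(G(W,U)) ≥ Σ_{j∈U} ℓ(j) + Σ_{k∈W} ℓ'(k) − R. -/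
open Matrix

/-- The rank of the block submatrix of `G` formed by the rows whose row-block index lies in `W`
and the columns whose column-block index lies in `U`. -/
noncomputable def blockRank {F : Type*} [Field F] {ρ γ ι κ : Type*} [Fintype ρ] [Fintype γ]
    [DecidableEq ι] [DecidableEq κ]
    (G : Matrix ρ γ F) (rblk : ρ → κ) (cblk : γ → ι)
    (W : Finset κ) (U : Finset ι) : ℕ :=
  (G.submatrix (fun r : {r : ρ // rblk r ∈ W} => r.1)
               (fun c : {c : γ // cblk c ∈ U} => c.1)).rank

/-- A block matrix `G` (with column blocks indexed by `ι` via `cblk` and row blocks indexed by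
`κ` via `rblk`) supports the flow `(ℓ; ℓ')` of rate `R` if there is an invertible `R × R`
submatrix of `G` using exactly `ℓ j` columns from the `j`-th column block and exactly
`ℓ' k` rows from the `k`-th row block. -/
def SupportsFlow {F : Type*} [Field F] {ρ γ ι κ : Type*} [DecidableEq ι] [DecidableEq κ]
    (G : Matrix ρ γ F) (rblk : ρ → κ) (cblk : γ → ι)
    (ℓ : ι → ℕ) (ℓ' : κ → ℕ) (R : ℕ) : Prop :=
  ∃ (r : Fin R → ρ) (c : Fin R → γ),
    Function.Injective r ∧ Function.Injective c ∧
    (∀ k : κ, (Finset.univ.filter fun i => rblk (r i) = k).card = ℓ' k) ∧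
    (∀ j : ι, (Finset.univ.filter fun i => cblk (c i) = j).card = ℓ j) ∧
    IsUnit (G.submatrix r c)

/-- For a submodular function, an element whose deletion lowers the value of a set also lowers the
value of every subset containing it. -/
theorem lt_of_erase_lt_of_subset {α : Type*} [DecidableEq α] {f : Finset α → ℕ}
    (hsub : ∀ X Y, f (X ∪ Y) + f (X ∩ Y) ≤ f X + f Y)
    {X Y : Finset α} (hYX : Y ⊆ X) {a : α} (ha : a ∈ Y) (h : f (X.erase a) < f X) :
    f (Y.erase a) < f Y := by
  have key := hsub Y (X.erase a)
  have h1 : Y ∪ X.erase a = X := by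
    ext x
    simp only [Finset.mem_union, Finset.mem_erase]
    by_cases hx : x = a
    · subst hx; simp [ha, hYX ha]
    · exact ⟨fun h => h.elim (fun h => hYX h) (fun h => h.2), fun h => Or.inr ⟨hx, h⟩⟩
  have h2 : Y ∩ X.erase a = Y.erase a := by
    ext x
    simp only [Finset.mem_inter, Finset.mem_erase]
    exact ⟨fun h => ⟨h.2.1, h.1⟩, fun h => ⟨h.2, h.1, hYX h.2⟩⟩
  rw [h1, h2] at key
  lia

/-- For a submodular function, deleting a set of elements, each of whose individual deletions
lowers the value, lowers the value by at least the cardinality of that set. -/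
theorem card_add_sdiff_le {α : Type*} [DecidableEq α] {f : Finset α → ℕ}
    (hsub : ∀ X Y, f (X ∪ Y) + f (X ∩ Y) ≤ f X + f Y)
    (X : Finset α) (S : Finset α) (hSX : S ⊆ X) (hS : ∀ a ∈ S, f (X.erase a) < f X) :
    S.card + f (X \ S) ≤ f X := by
  induction S using Finset.induction_on with
  | empty => simp
  | insert a S haS ih =>
    have ih := ih (fun x hx => hSX (Finset.mem_insert_of_mem hx))
      (fun x hx => hS x (Finset.mem_insert_of_mem hx))
    have h := lt_of_erase_lt_of_subset hsub (Finset.sdiff_subset (s := X) (t := S))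
      (Finset.mem_sdiff.2 ⟨hSX (Finset.mem_insert_self a S), haS⟩)
      (hS a (Finset.mem_insert_self a S))
    rw [Finset.card_insert_of_notMem haS, Finset.sdiff_insert]
    lia

/-- **Rado's theorem** for a partition with multiplicities: if a submodular function `f`
meets the total demand on every union of blocks, then some set `B` contains exactly the demanded
number of elements of each block and still meets the total demand on every union of blocks. -/
theorem exists_transversal_of_sum_le {α β : Type*} [Fintype α] [DecidableEq α] [DecidableEq β]
    (f : Finset α → ℕ) (hcard : ∀ X, f X ≤ X.card)
    (hsub : ∀ X Y, f (X ∪ Y) + f (X ∩ Y) ≤ f X + f Y)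
    (blk : α → β) (n : β → ℕ)
    (h : ∀ K : Finset β, ∑ k ∈ K, n k ≤ f {a | blk a ∈ K}) :
    ∃ B : Finset α, (∀ k, (B.filter fun a => blk a = k).card = n k) ∧
      ∀ K : Finset β, ∑ k ∈ K, n k ≤ f (B.filter fun a => blk a ∈ K) := by
  obtain ⟨A, hA, hmin⟩ := WellFounded.has_min (wellFounded_lt (α := Finset α))
    {A | ∀ K : Finset β, ∑ k ∈ K, n k ≤ f (A.filter fun a => blk a ∈ K)} ⟨Finset.univ, h⟩
  refine ⟨A, fun k => ?_, hA⟩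
  set N : Finset β → ℕ := fun K => ∑ k ∈ K, n k with hN
  set r : Finset β → ℕ := fun K => f (A.filter fun a => blk a ∈ K) with hr
  have hA' : ∀ K, N K ≤ r K := hA
  have hge : n k ≤ (A.filter fun a => blk a = k).card := by
    have := (hA {k}).trans (hcard _)
    simpa using this
  refine le_antisymm (not_lt.1 fun hlt => ?_) hge
  have htight : ∀ a ∈ A, blk a = k → ∃ K : Finset β, k ∈ K ∧ r K = N K ∧
      f ((A.filter fun x => blk x ∈ K).erase a) < r K := by
    intro a ha hak
    have h1 := mt (hmin (A.erase a)) (not_not.2 (Finset.erase_ssubset ha))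
    simp only [Set.mem_ofPred_eq, not_forall, not_le] at h1
    obtain ⟨K, hK⟩ := h1
    rw [Finset.filter_erase] at hK
    have hkK : k ∈ K := by
      by_contra hk
      rw [Finset.erase_eq_of_notMem (by simp [hak, hk])] at hK
      exact absurd (hA K) (not_le.2 hK)
    refine ⟨K, hkK, ?_, hK.trans_le (hA K)⟩
    have haK : a ∈ A.filter fun x => blk x ∈ K := by simp [ha, hak, hkK]
    have h2 := hsub ((A.filter fun x => blk x ∈ K).erase a) {a}
    rw [Finset.union_comm, ← Finset.insert_eq, Finset.insert_erase haK] at h2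
    have h3 := hcard {a}
    have h4 := hA K
    simp only [Finset.card_singleton] at h3
    simp only [hN, hr]
    lia
  have hinter : ∀ K L, r K = N K → r L = N L → r (K ∩ L) = N (K ∩ L) := by
    intro K L hK hL
    have h1 := hsub (A.filter fun x => blk x ∈ K) (A.filter fun x => blk x ∈ L)
    rw [← Finset.filter_or, ← Finset.filter_and] at h1
    simp only [← Finset.mem_union, ← Finset.mem_inter] at h1
    have h2 := hA' (K ∪ L)
    have h3 := hA' (K ∩ L)
    have h4 : N (K ∪ L) + N (K ∩ L) = N K + N L := Finset.sum_union_inter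
    have h5 : r (K ∪ L) + r (K ∩ L) ≤ r K + r L := h1
    lia
  have hne : (A.filter fun a => blk a = k).Nonempty := Finset.card_pos.1 (by lia)
  obtain ⟨a₀, ha₀⟩ := hne
  rw [Finset.mem_filter] at ha₀
  obtain ⟨K₀, hkK₀, hK₀, -⟩ := htight a₀ ha₀.1 ha₀.2
  obtain ⟨K, ⟨hkK, hK⟩, hKmin⟩ := WellFounded.has_min (wellFounded_lt (α := Finset β))
    {K | k ∈ K ∧ r K = N K} ⟨K₀, hkK₀, hK₀⟩
  have hcol := card_add_sdiff_le hsub (A.filter fun a => blk a ∈ K)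
    (A.filter fun a => blk a = k)
    (Finset.monotone_filter_right _ fun a _ (ha : blk a = k) => ha ▸ hkK) (by
      intro a ha
      rw [Finset.mem_filter] at ha
      obtain ⟨L, hkL, hL, hlt⟩ := htight a ha.1 ha.2
      have hKL : K ⊆ L := by
        have h1 := hKmin (K ∩ L) ⟨Finset.mem_inter.2 ⟨hkK, hkL⟩, hinter K L hK hL⟩
        have h2 := eq_of_le_of_not_lt (Finset.inter_subset_left (s₁ := K) (s₂ := L)) h1
        exact Finset.inter_eq_left.1 h2
      exact lt_of_erase_lt_of_subset hsub
        (Finset.monotone_filter_right _ fun x _ hx => hKL hx)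
        (by simp [ha.1, ha.2, hkK]) hlt)
  have hsd : (A.filter fun a => blk a ∈ K) \ (A.filter fun a => blk a = k)
      = A.filter fun a => blk a ∈ K.erase k := by
    ext x
    simp only [Finset.mem_sdiff, Finset.mem_filter, Finset.mem_erase]
    tauto
  rw [hsd] at hcol
  have h1 : N (K.erase k) ≤ f (A.filter fun a => blk a ∈ K.erase k) := hA' _
  have h2 : N (K.erase k) + n k = N K := Finset.sum_erase_add K n hkK
  have h3 : f (A.filter fun a => blk a ∈ K) = N K := hK
  lia

/-- The dimension of the span of a finite subfamily of a family of vectors. -/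
noncomputable def spanRank (F : Type*) {V α : Type*} [Field F] [AddCommGroup V] [Module F V]
    (v : α → V) (X : Finset α) : ℕ :=
  Module.finrank F (Submodule.span F (v '' X))

/-- The dimension of the span of a subfamily of vectors is submodular. -/
theorem spanRank_submodular {F V α : Type*} [Field F] [AddCommGroup V] [Module F V]
    [DecidableEq α] (v : α → V) (X Y : Finset α) :
    spanRank F v (X ∪ Y) + spanRank F v (X ∩ Y) ≤ spanRank F v X + spanRank F v Y := by
  unfold spanRank
  have : FiniteDimensional F (Submodule.span F (v '' (X : Set α))) :=
    FiniteDimensional.span_of_finite F (X.finite_toSet.image v)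
  have : FiniteDimensional F (Submodule.span F (v '' (Y : Set α))) :=
    FiniteDimensional.span_of_finite F (Y.finite_toSet.image v)
  have h := Submodule.finrank_sup_add_finrank_inf_eq (Submodule.span F (v '' (X : Set α)))
    (Submodule.span F (v '' (Y : Set α)))
  rw [← h, Finset.coe_union, Set.image_union, Submodule.span_union]
  refine Nat.add_le_add_left (Submodule.finrank_mono (le_inf
    (Submodule.span_mono (Set.image_mono ?_)) (Submodule.span_mono (Set.image_mono ?_)))) _
  · exact Finset.coe_subset.2 Finset.inter_subset_left
  · exact Finset.coe_subset.2 Finset.inter_subset_right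

/-- The dimension of the span of a subfamily of vectors is at most its cardinality. -/
theorem spanRank_le_card {F V α : Type*} [Field F] [AddCommGroup V] [Module F V]
    (v : α → V) (X : Finset α) :
    spanRank F v X ≤ X.card := by
  classical
  have h := finrank_span_finset_le_card (R := F) (X.image v)
  rw [Finset.coe_image] at h
  exact h.trans Finset.card_image_le

/-- The columns of the block matrix `[1 | G]`, indexed by the rows and the columns of `G`. -/
def augmentedCol {F ρ γ : Type*} [Field F] [DecidableEq ρ] (G : Matrix ρ γ F) :
    ρ ⊕ γ → ρ → F :=
  Sum.elim (fun r => Pi.single r 1) G.col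

/-- The rank of a set of columns of `[1 | G]` is the number of unit vectors it contains, plus the
rank of `G` on its remaining columns and on the rows not covered by these unit vectors. -/
theorem spanRank_augmentedCol {F ρ γ : Type*} [Field F] [Fintype ρ] [Fintype γ]
    [DecidableEq ρ] (G : Matrix ρ γ F) (X : Finset (ρ ⊕ γ)) :
    spanRank F (augmentedCol G) X =
      X.toLeft.card + (G.submatrix (fun r : {r // r ∉ X.toLeft} => r.1)
        (fun c : {c // c ∈ X.toRight} => c.1)).rank := by
  unfold spanRank
  set P := Submodule.span F (augmentedCol G '' X) with hP
  set π : (ρ → F) →ₗ[F] ({r // r ∉ X.toLeft} → F) := LinearMap.funLeft F F Subtype.val with hπ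
  have hsurj : Function.Surjective π :=
    LinearMap.funLeft_surjective_of_injective F F _ Subtype.val_injective
  have hker : Module.finrank F (LinearMap.ker π) = X.toLeft.card := by
    have h1 := LinearMap.finrank_range_add_finrank_ker π
    rw [LinearMap.range_eq_top.2 hsurj, finrank_top, Module.finrank_fintype_fun_eq_card,
      Module.finrank_fintype_fun_eq_card] at h1
    have h2 := Fintype.card_subtype_compl (fun r => r ∈ X.toLeft)
    rw [Fintype.card_coe] at h2
    have h3 := Finset.card_le_univ X.toLeft
    lia
  have hle : LinearMap.ker π ≤ P := by
    intro x hx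
    have hx0 : ∀ r, r ∉ X.toLeft → x r = 0 := fun r hr => congrFun hx ⟨r, hr⟩
    rw [pi_eq_sum_univ' x]
    refine Submodule.sum_mem _ fun r _ => ?_
    by_cases hr : r ∈ X.toLeft
    · refine Submodule.smul_mem _ _ (Submodule.subset_span ⟨Sum.inl r, by simpa using hr, ?_⟩)
      ext i
      simp [augmentedCol, Pi.single_apply, eq_comm]
    · rw [hx0 r hr, zero_smul]
      exact Submodule.zero_mem _
  have hmap : P.map π = Submodule.span F (Set.range (G.submatrix
      (fun r : {r // r ∉ X.toLeft} => r.1) (fun c : {c // c ∈ X.toRight} => c.1)).col) := by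
    rw [hP, Submodule.map_span]
    refine le_antisymm (Submodule.span_le.2 ?_) (Submodule.span_le.2 ?_)
    · rintro _ ⟨_, ⟨r | c, hx, rfl⟩, rfl⟩
      · have : π (augmentedCol G (Sum.inl r)) = 0 := by
          ext ⟨i, hi⟩
          have : i ≠ r := by rintro rfl; exact hi (by simpa using hx)
          simp [hπ, augmentedCol, LinearMap.funLeft_apply, this]
        rw [this]
        exact Submodule.zero_mem _
      · exact Submodule.subset_span ⟨⟨c, by simpa using hx⟩, rfl⟩
    · rintro _ ⟨⟨c, hc⟩, rfl⟩
      exact Submodule.subset_span ⟨_, ⟨Sum.inr c, by simpa using hc, rfl⟩, rfl⟩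
  have h1 := LinearMap.finrank_range_add_finrank_ker (π.domRestrict P)
  rw [LinearMap.range_domRestrict, LinearMap.ker_domRestrict, hmap,
    (Submodule.comapSubtypeEquivOfLe hle).finrank_eq, hker,
    ← Matrix.rank_eq_finrank_span_cols] at h1
  lia

/-- If two linear maps on `V` have trivial joint kernel, then the dimension of `V` is at most the
rank of the first plus the dimension of the codomain of the second. -/
theorem finrank_le_finrank_range_add {F V V₁ V₂ : Type*} [Field F] [AddCommGroup V] [Module F V]
    [AddCommGroup V₁] [Module F V₁] [AddCommGroup V₂] [Module F V₂]
    [FiniteDimensional F V] [FiniteDimensional F V₂] (f : V →ₗ[F] V₁) (g : V →ₗ[F] V₂)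
    (h : ∀ x, f x = 0 → g x = 0 → x = 0) :
    Module.finrank F V ≤ Module.finrank F (LinearMap.range f) + Module.finrank F V₂ := by
  rw [← Module.finrank_prod]
  refine LinearMap.finrank_le_finrank_of_injective (f := f.rangeRestrict.prod g)
    ((injective_iff_map_eq_zero _).2 fun x hx => ?_)
  exact h x (congrArg (fun y => (y.1 : V₁)) hx) (congrArg Prod.snd hx)

/-- In an invertible matrix, the submatrix on `p`-rows and `q`-columns has rank at least the
number of `q`-columns minus the number of the other rows. -/
theorem card_le_rank_submatrix_add {F ι : Type*} [Field F] [Fintype ι] [DecidableEq ι]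
    (A : Matrix ι ι F) (hA : IsUnit A) (p q : ι → Prop) [DecidablePred p] [DecidablePred q] :
    Fintype.card {i // q i} ≤
      (A.submatrix (fun i : {i // p i} => i.1) (fun i : {i // q i} => i.1)).rank +
        Fintype.card {i // ¬ p i} := by
  have h := finrank_le_finrank_range_add
    (A.submatrix (fun i : {i // p i} => i.1) (fun i : {i // q i} => i.1)).mulVecLin
    (A.submatrix (fun i : {i // ¬ p i} => i.1) (fun i : {i // q i} => i.1)).mulVecLin (by
      intro x h1 h2
      have hli := (Matrix.linearIndependent_cols_iff_isUnit.2 hA).comp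
        (Subtype.val : {i // q i} → ι) Subtype.val_injective
      refine funext (Fintype.linearIndependent_iff.1 hli x (funext fun i => ?_))
      by_cases hi : p i
      · simpa [Matrix.mulVec, dotProduct, mul_comm] using congrFun h1 ⟨i, hi⟩
      · simpa [Matrix.mulVec, dotProduct, mul_comm] using congrFun h2 ⟨i, hi⟩)
  rwa [Module.finrank_fintype_fun_eq_card, Module.finrank_fintype_fun_eq_card] at h

/-- Enumerating a finset preserves the number of elements in each block. -/
theorem card_filter_equivFinOfCardEq {α β : Type*} [DecidableEq β] {R : ℕ} (S : Finset α)
    (hS : S.card = R) (blk : α → β) (b : β) :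
    (Finset.univ.filter fun i => blk ((S.equivFinOfCardEq hS).symm i).1 = b).card =
      (S.filter fun a => blk a = b).card := by
  refine Finset.card_bij (fun i _ => ((S.equivFinOfCardEq hS).symm i).1) ?_ ?_ ?_
  · intro i hi
    simpa using hi
  · intro i _ j _ hij
    exact (S.equivFinOfCardEq hS).symm.injective (Subtype.ext hij)
  · intro a ha
    rw [Finset.mem_filter] at ha
    exact ⟨S.equivFinOfCardEq hS ⟨a, ha.1⟩, by simp [ha.2], by simp⟩

/-- The rank inequalities hold for a block matrix that supports a flow. -/
theorem SupportsFlow.sum_le_blockRank_add {F : Type*} [Field F] {ρ γ ι κ : Type*} [Fintype ρ]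
    [Fintype γ] [DecidableEq ι] [DecidableEq κ] {G : Matrix ρ γ F} {rblk : ρ → κ}
    {cblk : γ → ι} {ℓ : ι → ℕ} {ℓ' : κ → ℕ} {R : ℕ}
    (h : SupportsFlow G rblk cblk ℓ ℓ' R) (U : Finset ι) (W : Finset κ) :
    ∑ j ∈ U, ℓ j + ∑ k ∈ W, ℓ' k ≤ blockRank G rblk cblk W U + R := by
  obtain ⟨r, c, -, -, hr, hc, hA⟩ := h
  have hle := card_le_rank_submatrix_add (G.submatrix r c) hA (fun i => rblk (r i) ∈ W)
    (fun i => cblk (c i) ∈ U)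
  have hrank : ((G.submatrix r c).submatrix (fun i : {i // rblk (r i) ∈ W} => i.1)
      (fun i : {i // cblk (c i) ∈ U} => i.1)).rank ≤ blockRank G rblk cblk W U :=
    Matrix.rank_submatrix_le
      (G.submatrix (fun r : {r : ρ // rblk r ∈ W} => r.1) (fun c : {c : γ // cblk c ∈ U} => c.1))
      (fun i : {i // rblk (r i) ∈ W} => ⟨r i.1, i.2⟩)
      (fun i : {i // cblk (c i) ∈ U} => ⟨c i.1, i.2⟩)
  have hU : Fintype.card {i // cblk (c i) ∈ U} = ∑ j ∈ U, ℓ j := by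
    rw [Fintype.card_subtype, Finset.card_eq_sum_card_fiberwise (f := fun i => cblk (c i)) (t := U)
      (fun i hi => by simpa using hi)]
    refine Finset.sum_congr rfl fun j hj => ?_
    rw [← hc j, Finset.filter_filter]
    congr 1
    ext i
    simp only [Finset.mem_filter, Finset.mem_univ, true_and]
    exact ⟨fun h => h.2, fun h => ⟨h ▸ hj, h⟩⟩
  have hW : Fintype.card {i // rblk (r i) ∈ W} = ∑ k ∈ W, ℓ' k := by
    rw [Fintype.card_subtype, Finset.card_eq_sum_card_fiberwise (f := fun i => rblk (r i)) (t := W)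
      (fun i hi => by simpa using hi)]
    refine Finset.sum_congr rfl fun k hk => ?_
    rw [← hr k, Finset.filter_filter]
    congr 1
    ext i
    simp only [Finset.mem_filter, Finset.mem_univ, true_and]
    exact ⟨fun h => h.2, fun h => ⟨h ▸ hk, h⟩⟩
  have hWc := Fintype.card_subtype_compl (fun i => rblk (r i) ∈ W)
  rw [Fintype.card_fin] at hWc
  have := Fintype.card_subtype_le (fun i => rblk (r i) ∈ W)
  rw [Fintype.card_fin] at this
  lia

/-- A block matrix with a square submatrix of full rank on a row set and a column set with the
prescribed block sizes supports the flow. -/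
theorem supportsFlow_of_rank {F : Type*} [Field F] {ρ γ ι κ : Type*}
    [DecidableEq ι] [DecidableEq κ] {G : Matrix ρ γ F} {rblk : ρ → κ}
    {cblk : γ → ι} {ℓ : ι → ℕ} {ℓ' : κ → ℕ} {R : ℕ} (T : Finset ρ) (S : Finset γ)
    (hT : T.card = R) (hS : S.card = R)
    (hTk : ∀ k, (T.filter fun r => rblk r = k).card = ℓ' k)
    (hSj : ∀ j, (S.filter fun c => cblk c = j).card = ℓ j)
    (hrank : R ≤ (G.submatrix (fun r : {r // r ∈ T} => r.1) (fun c : {c // c ∈ S} => c.1)).rank) :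
    SupportsFlow G rblk cblk ℓ ℓ' R := by
  refine ⟨fun i => ((T.equivFinOfCardEq hT).symm i).1, fun i => ((S.equivFinOfCardEq hS).symm i).1,
    Subtype.val_injective.comp (Equiv.injective _), Subtype.val_injective.comp (Equiv.injective _),
    fun k => (card_filter_equivFinOfCardEq T hT rblk k).trans (hTk k),
    fun j => (card_filter_equivFinOfCardEq S hS cblk j).trans (hSj j), ?_⟩
  rw [← Matrix.linearIndependent_cols_iff_isUnit, linearIndependent_iff_card_le_finrank_span,
    Fintype.card_fin, Set.finrank, ← Matrix.rank_eq_finrank_span_cols]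
  rwa [← Matrix.rank_submatrix _ (T.equivFinOfCardEq hT).symm (S.equivFinOfCardEq hS).symm] at hrank

/-- The number of rows in a union of row blocks, split according to a row demand `ℓ'`. -/
theorem sum_card_filter_sub_add_sum {ρ κ : Type*} [Fintype ρ] [DecidableEq κ] (rblk : ρ → κ)
    (ℓ' : κ → ℕ) (hrow : ∀ k, ℓ' k ≤ (Finset.univ.filter fun r => rblk r = k).card)
    (W : Finset κ) :
    ∑ k ∈ W, ((Finset.univ.filter fun r => rblk r = k).card - ℓ' k) + ∑ k ∈ W, ℓ' k =
      (Finset.univ.filter fun r => rblk r ∈ W).card := by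
  rw [← Finset.sum_add_distrib, Finset.card_eq_sum_card_fiberwise (f := rblk) (t := W)
    (fun i hi => by simpa using hi)]
  refine Finset.sum_congr rfl fun k hk => ?_
  rw [Nat.sub_add_cancel (hrow k), Finset.filter_filter]
  congr 1
  ext r
  simp only [Finset.mem_filter, Finset.mem_univ, true_and]
  exact ⟨fun h => ⟨h ▸ hk, h⟩, fun h => h.2⟩

/-- The rank inequalities for `G` imply Rado's condition for the columns of `[1 | G]`. -/
theorem sum_le_spanRank_augmentedCol {F : Type*} [Field F] {ρ γ ι κ : Type*} [Fintype ρ]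
    [Fintype γ] [DecidableEq ρ] [Fintype κ] [DecidableEq ι] [DecidableEq κ]
    (G : Matrix ρ γ F) (rblk : ρ → κ) (cblk : γ → ι) (ℓ : ι → ℕ) (ℓ' : κ → ℕ) (R : ℕ)
    (hℓ' : ∑ k, ℓ' k = R)
    (hrow : ∀ k, ℓ' k ≤ (Finset.univ.filter fun r => rblk r = k).card)
    (h : ∀ (U : Finset ι) (W : Finset κ),
      ∑ j ∈ U, ℓ j + ∑ k ∈ W, ℓ' k ≤ blockRank G rblk cblk W U + R)
    (K : Finset (κ ⊕ ι)) :
    ∑ k ∈ K, Sum.elim (fun k => (Finset.univ.filter fun r => rblk r = k).card - ℓ' k) ℓ k ≤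
      spanRank F (augmentedCol G) {a | Sum.map rblk cblk a ∈ K} := by
  have h1 := h K.toRight K.toLeftᶜ
  have h2 := sum_card_filter_sub_add_sum rblk ℓ' hrow K.toLeft
  have h3 : ∑ k ∈ K.toLeft, ℓ' k + ∑ k ∈ K.toLeftᶜ, ℓ' k = R :=
    (Finset.sum_add_sum_compl _ _).trans hℓ'
  set X : Finset (ρ ⊕ γ) := {a | Sum.map rblk cblk a ∈ K} with hX
  have hXl : X.toLeft = Finset.univ.filter fun r => rblk r ∈ K.toLeft := by
    ext r; simp [hX]
  have h4 : blockRank G rblk cblk K.toLeftᶜ K.toRight ≤ (G.submatrix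
      (fun r : {r // r ∉ X.toLeft} => r.1) (fun c : {c // c ∈ X.toRight} => c.1)).rank :=
    Matrix.rank_submatrix_le (G.submatrix
      (fun r : {r // r ∉ X.toLeft} => r.1) (fun c : {c // c ∈ X.toRight} => c.1))
      (fun r : {r // rblk r ∈ K.toLeftᶜ} => ⟨r.1, by simpa [hX] using r.2⟩)
      (fun c : {c // cblk c ∈ K.toRight} => ⟨c.1, by simpa [hX] using c.2⟩)
  rw [Finset.sum_sum_eq_sum_toLeft_add_sum_toRight, spanRank_augmentedCol, hXl]
  rw [hXl] at h4
  simp only [Sum.elim_inl, Sum.elim_inr]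
  lia

/-- A block matrix satisfying the rank inequalities supports the flow. -/
theorem supportsFlow_of_sum_le_blockRank_add {F : Type*} [Field F] {ρ γ ι κ : Type*} [Fintype ρ]
    [Fintype γ] [DecidableEq ρ] [DecidableEq γ] [Fintype ι] [Fintype κ] [DecidableEq ι]
    [DecidableEq κ] (G : Matrix ρ γ F) (rblk : ρ → κ) (cblk : γ → ι) (ℓ : ι → ℕ) (ℓ' : κ → ℕ)
    (R : ℕ) (hℓ : ∑ j, ℓ j = R) (hℓ' : ∑ k, ℓ' k = R)
    (h : ∀ (U : Finset ι) (W : Finset κ),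
      ∑ j ∈ U, ℓ j + ∑ k ∈ W, ℓ' k ≤ blockRank G rblk cblk W U + R) :
    SupportsFlow G rblk cblk ℓ ℓ' R := by
  have hrow : ∀ k, ℓ' k ≤ (Finset.univ.filter fun r => rblk r = k).card := by
    intro k
    have h1 := h Finset.univ {k}
    have h2 : blockRank G rblk cblk {k} Finset.univ ≤ _ := Matrix.rank_le_card_height _
    rw [Fintype.card_subtype] at h2
    simp only [Finset.sum_singleton, Finset.mem_singleton] at h1 h2
    lia
  obtain ⟨B, hB, hBK⟩ := exists_transversal_of_sum_le
    (spanRank F (augmentedCol G))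
    (spanRank_le_card _)
    (spanRank_submodular _) (Sum.map rblk cblk)
    (Sum.elim (fun k => (Finset.univ.filter fun r => rblk r = k).card - ℓ' k) ℓ)
    (sum_le_spanRank_augmentedCol G rblk cblk ℓ ℓ' R hℓ' hrow h)
  have hleft : ∀ k, (B.toLeft.filter fun r => rblk r = k).card
      = (Finset.univ.filter fun r => rblk r = k).card - ℓ' k := by
    intro k
    rw [← Finset.card_map Function.Embedding.inl]
    refine Eq.trans (congrArg Finset.card ?_) (hB (Sum.inl k))
    ext (r | c) <;> simp
  have hright : ∀ j, (B.toRight.filter fun c => cblk c = j).card = ℓ j := by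
    intro j
    rw [← Finset.card_map Function.Embedding.inr]
    refine Eq.trans (congrArg Finset.card ?_) (hB (Sum.inr j))
    ext (r | c) <;> simp
  have hTk : ∀ k, (B.toLeftᶜ.filter fun r => rblk r = k).card = ℓ' k := by
    intro k
    have h1 := Finset.card_union_of_disjoint (Finset.disjoint_filter_filter (p := fun r => rblk r = k)
      (q := fun r => rblk r = k) (disjoint_compl_right (a := B.toLeft)))
    rw [← Finset.filter_union, Finset.union_compl, hleft] at h1
    have := hrow k
    lia
  have hS : B.toRight.card = R := by
    rw [Finset.card_eq_sum_card_fiberwise (f := cblk) (t := Finset.univ) (by simp), ← hℓ]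
    exact Finset.sum_congr rfl fun j _ => hright j
  have hT : B.toLeftᶜ.card = R := by
    rw [Finset.card_eq_sum_card_fiberwise (f := rblk) (t := Finset.univ) (by simp), ← hℓ']
    exact Finset.sum_congr rfl fun k _ => hTk k
  refine supportsFlow_of_rank B.toLeftᶜ B.toRight hT hS hTk hright ?_
  have h1 := hBK Finset.univ
  have h2 := sum_card_filter_sub_add_sum rblk ℓ' hrow Finset.univ
  simp only [Finset.mem_univ, Finset.filter_true] at h1 h2
  rw [Finset.sum_sum_eq_sum_toLeft_add_sum_toRight, spanRank_augmentedCol] at h1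
  simp only [Finset.toLeft_univ, Finset.toRight_univ, Sum.elim_inl, Sum.elim_inr, hℓ] at h1
  rw [hℓ'] at h2
  have h3 := Finset.card_add_card_compl B.toLeft
  rw [← Finset.card_univ] at h3
  have h4 : (G.submatrix (fun r : {r // r ∉ B.toLeft} => r.1)
      (fun c : {c // c ∈ B.toRight} => c.1)).rank ≤ (G.submatrix
      (fun r : {r // r ∈ B.toLeftᶜ} => r.1) (fun c : {c // c ∈ B.toRight} => c.1)).rank :=
    Matrix.rank_submatrix_le (G.submatrix
      (fun r : {r // r ∈ B.toLeftᶜ} => r.1) (fun c : {c // c ∈ B.toRight} => c.1))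
      (fun r : {r // r ∉ B.toLeft} => ⟨r.1, Finset.mem_compl.2 r.2⟩) id
  lia

/-- **Two-dimensional Rado–Hall theorem.** A block matrix `G` supports the flow
`d = (ℓ(1),…,ℓ(m); ℓ'(1),…,ℓ'(m'))` of rate `R` if and only if for all sets `U` of column-block
indices and `W` of row-block indices,
`rank G(W,U) ≥ ∑_{j∈U} ℓ j + ∑_{k∈W} ℓ' k − R`. -/
theorem stmt_0 {F : Type*} [Field F] {ρ γ : Type*} [Fintype ρ] [Fintype γ] {m m' : ℕ}
    (G : Matrix ρ γ F) (rblk : ρ → Fin m') (cblk : γ → Fin m)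
    (ℓ : Fin m → ℕ) (ℓ' : Fin m' → ℕ) (R : ℕ)
    (hℓ : ∑ j, ℓ j = R) (hℓ' : ∑ k, ℓ' k = R) :
    SupportsFlow G rblk cblk ℓ ℓ' R ↔
      ∀ (U : Finset (Fin m)) (W : Finset (Fin m')),
        ∑ j ∈ U, ℓ j + ∑ k ∈ W, ℓ' k ≤ blockRank G rblk cblk W U + R := by
  classical
  exact ⟨fun h => h.sum_le_blockRank_add,
    supportsFlow_of_sum_le_blockRank_add G rblk cblk ℓ ℓ' R hℓ hℓ'⟩
end

section
/- Let H be a matrix over a field whose columns are partitioned into blocks labeled 1,…,m, and let ℓ_1,…,ℓ_m be nonnegative integers. There exist ℓ_1+⋯+ℓ_m linearly independent columns of H with exactly ℓ_i of them taken from the i-th column block for each i ∈ {1,…,m} if and only if for every U ⊆ {1,…,m} one has rank(H(U)) ≥ Σ_{i∈U} ℓ_i, where H(U) denotes the submatrix of H formed by the column blocks with indices in U. -/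
open Matrix

open Classical in
/-- If two distinct points `x`, `y` of `A i` are given, then one of them can be removed without
destroying Rado's rank condition. -/
theorem rado_condition_erase {F V ι : Type*} [Field F] [AddCommGroup V] [Module F V]
    [FiniteDimensional F V] {A : ι → Finset V}
    (hA : ∀ K : Finset ι, K.card ≤ Module.finrank F ↥(K.sup fun j => Submodule.span F (A j : Set V)))
    {i : ι} {x y : V} (hxy : x ≠ y) :
    ∃ z ∈ ({x, y} : Set V), ∀ K : Finset ι, K.card ≤ Module.finrank F
      ↥(K.sup fun j => Submodule.span F (Function.update A i ((A i).erase z) j : Set V)) := by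
  have key : ∀ z : V, (¬ ∀ K : Finset ι, K.card ≤ Module.finrank F
      ↥(K.sup fun j => Submodule.span F (Function.update A i ((A i).erase z) j : Set V))) →
      ∃ K : Finset ι, i ∉ K ∧ Module.finrank F ↥(Submodule.span F ((A i).erase z : Set V) ⊔
        K.sup fun j => Submodule.span F (A j : Set V)) ≤ K.card := by
    intro z hz
    push Not at hz
    obtain ⟨K, hK⟩ := hz
    have hsup : ∀ L : Finset ι, i ∉ L →
        (L.sup fun j => Submodule.span F (Function.update A i ((A i).erase z) j : Set V)) =
          L.sup fun j => Submodule.span F (A j : Set V) := fun L hL =>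
      Finset.sup_congr rfl fun j hj => by
        rw [Function.update_of_ne (ne_of_mem_of_not_mem hj hL)]
    by_cases hi : i ∈ K
    · refine ⟨K.erase i, Finset.notMem_erase i K, ?_⟩
      rw [← Finset.insert_erase hi, Finset.sup_insert, Function.update_self,
        hsup _ (Finset.notMem_erase i K),
        Finset.card_insert_of_notMem (Finset.notMem_erase i K)] at hK
      exact Nat.lt_succ_iff.mp hK
    · rw [hsup K hi] at hK
      exact absurd (hA K) hK.not_ge
  by_contra! h
  obtain ⟨K, hiK, hK⟩ := key x (by simpa using h x (by simp))
  obtain ⟨L, hiL, hL⟩ := key y (by simpa using h y (by simp))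
  set W : Finset ι → Submodule F V := fun M => M.sup fun j => Submodule.span F (A j : Set V)
  set P := Submodule.span F ((A i).erase x : Set V) ⊔ W K
  set Q := Submodule.span F ((A i).erase y : Set V) ⊔ W L
  have hsup : W (insert i (K ∪ L)) ≤ P ⊔ Q := by
    simp only [W, Finset.sup_insert, Finset.sup_union]
    refine sup_le (Submodule.span_le.mpr fun v hv => ?_)
      (sup_le_sup le_sup_right le_sup_right)
    by_cases hvx : v = x
    · exact (le_sup_of_le_right le_sup_left : _ ≤ P ⊔ Q)
        (Submodule.subset_span (Finset.mem_coe.mpr (Finset.mem_erase.mpr ⟨hvx ▸ hxy, hv⟩)))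
    · exact (le_sup_of_le_left le_sup_left : _ ≤ P ⊔ Q)
        (Submodule.subset_span (Finset.mem_coe.mpr (Finset.mem_erase.mpr ⟨hvx, hv⟩)))
  have hinf : W (K ∩ L) ≤ P ⊓ Q :=
    le_inf (le_sup_of_le_right (Finset.sup_mono Finset.inter_subset_left))
      (le_sup_of_le_right (Finset.sup_mono Finset.inter_subset_right))
  have h1 := (hA (insert i (K ∪ L))).trans (Submodule.finrank_mono hsup)
  have h2 := (hA (K ∩ L)).trans (Submodule.finrank_mono hinf)
  rw [Finset.card_insert_of_notMem (by simp [hiK, hiL])] at h1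
  have h3 := Submodule.finrank_sup_add_finrank_inf_eq P Q
  have h4 := Finset.card_union_add_card_inter K L
  omega

open Classical in
/-- **Rado's theorem** for vectors: a finite family of finite sets of vectors has a linearly
independent transversal as soon as the union of any `k` of the sets has rank at least `k`. -/
theorem exists_linearIndependent_transversal {F V ι : Type*} [Field F] [AddCommGroup V]
    [Module F V] [FiniteDimensional F V] [Fintype ι] (A : ι → Finset V)
    (hA : ∀ K : Finset ι,
      K.card ≤ Module.finrank F ↥(K.sup fun j => Submodule.span F (A j : Set V))) :
    ∃ f : ι → V, (∀ i, f i ∈ A i) ∧ LinearIndependent F f := by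
  induction hn : ∑ i, (A i).card using Nat.strong_induction_on generalizing A with
  | _ n ih =>
    subst hn
    by_cases hcard : ∃ i, 1 < (A i).card
    · obtain ⟨i, hi⟩ := hcard
      obtain ⟨x, hx, y, hy, hxy⟩ := Finset.one_lt_card.mp hi
      obtain ⟨z, hz, hB⟩ := rado_condition_erase hA (i := i) hxy
      have hzA : z ∈ A i := by
        rcases hz with rfl | rfl <;> assumption
      have hsub : ∀ j, Function.update A i ((A i).erase z) j ⊆ A j := by
        intro j
        rcases eq_or_ne j i with rfl | hj
        · simpa using Finset.erase_subset z (A j)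
        · rw [Function.update_of_ne hj]
      obtain ⟨f, hf, hli⟩ := ih _ (Finset.sum_lt_sum (fun j _ => Finset.card_le_card (hsub j))
        ⟨i, Finset.mem_univ i, by simpa using Finset.card_erase_lt_of_mem hzA⟩) _ hB rfl
      exact ⟨f, fun j => hsub j (hf j), hli⟩
    · push Not at hcard
      have hne : ∀ i, (A i).Nonempty := by
        intro i
        by_contra h
        have := hA {i}
        simp [Finset.not_nonempty_iff_eq_empty.mp h] at this
      choose f hf using hne
      refine ⟨f, hf, linearIndependent_iff_card_le_finrank_span.mpr ?_⟩
      refine (hA Finset.univ).trans (Submodule.finrank_mono (Finset.sup_le fun i _ => ?_))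
      refine Submodule.span_mono fun v hv => ⟨i, ?_⟩
      exact Finset.card_le_one.mp (hcard i) _ (hf i) _ hv

/-- **The Rado–Hall theorem for matrices.** Let `H` be a matrix over a field whose columns are
partitioned into blocks labeled by `Fin m` (via `cblk`), and let `ℓ 1, …, ℓ m` be nonnegative
integers.  There exist `ℓ 1 + ⋯ + ℓ m` linearly independent columns of `H` with exactly `ℓ i` of
them taken from the `i`-th column block for each `i` if and only if for every `U ⊆ {1,…,m}` one has
`rank (H(U)) ≥ ∑_{i ∈ U} ℓ i`, where `H(U)` is the submatrix of `H` formed by the column blocks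
with indices in `U`. -/
theorem stmt_1 {F : Type*} [Field F] {ρ γ : Type*} [Fintype ρ] [Fintype γ] {m : ℕ}
    (H : Matrix ρ γ F) (cblk : γ → Fin m) (ℓ : Fin m → ℕ) :
    (∃ c : Fin (∑ i, ℓ i) → γ, Function.Injective c ∧
        (∀ i : Fin m, (Finset.univ.filter fun t => cblk (c t) = i).card = ℓ i) ∧
        LinearIndependent F (fun t : Fin (∑ i, ℓ i) => fun r : ρ => H r (c t))) ↔
      ∀ U : Finset (Fin m),
        ∑ i ∈ U, ℓ i ≤ (H.submatrix (id : ρ → ρ) (fun c : {c : γ // cblk c ∈ U} => c.1)).rank := by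
  classical
  constructor
  · rintro ⟨c, -, hc, hli⟩ U
    have hcard : Fintype.card {t // cblk (c t) ∈ U} = ∑ i ∈ U, ℓ i := by
      rw [Fintype.card_subtype, Finset.card_eq_sum_card_fiberwise
        (f := fun t => cblk (c t)) (t := U) (fun t ht => by simpa using ht)]
      refine Finset.sum_congr rfl fun i hi => ?_
      rw [← hc i, Finset.filter_filter]
      congr 1
      ext t
      simp only [Finset.mem_filter, Finset.mem_univ, true_and, and_iff_right_iff_imp]
      rintro rfl
      exact hi
    rw [← hcard, Matrix.rank_eq_finrank_span_cols,
      ← finrank_span_eq_card (hli.comp (Subtype.val : {t // cblk (c t) ∈ U} → _)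
        Subtype.val_injective)]
    refine Submodule.finrank_mono (Submodule.span_mono ?_)
    rintro _ ⟨t, rfl⟩
    exact ⟨⟨c t, t.2⟩, rfl⟩
  · intro h
    let e : Fin (∑ i, ℓ i) ≃ Σ i, Fin (ℓ i) := finSigmaFinEquiv.symm
    have hfiber : ∀ i, (Finset.univ.filter fun t => (e t).1 = i).card = ℓ i := by
      intro i
      rw [← Fintype.card_subtype, Fintype.card_congr
        ((e.subtypeEquiv fun _ => Iff.rfl).trans (Equiv.sigmaSubtype i)), Fintype.card_fin]
    obtain ⟨f, hf, hli⟩ := exists_linearIndependent_transversal (F := F)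
      (fun t => (Finset.univ.filter fun d => cblk d = (e t).1).image fun d r => H r d) (by
        intro K
        refine le_trans ?_ ((h (K.image fun t => (e t).1)).trans ?_)
        · rw [Finset.card_eq_sum_card_image (fun t => (e t).1) K]
          refine Finset.sum_le_sum fun i _ => ?_
          rw [← hfiber i]
          exact Finset.card_le_card (Finset.filter_subset_filter _ (Finset.subset_univ K))
        · rw [Matrix.rank_eq_finrank_span_cols]
          refine Submodule.finrank_mono (Submodule.span_le.mpr ?_)
          rintro _ ⟨⟨d, hd⟩, rfl⟩
          obtain ⟨t, ht, htd⟩ := Finset.mem_image.mp hd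
          refine Finset.le_sup (f := fun t => Submodule.span F (((Finset.univ.filter
            fun d => cblk d = (e t).1).image fun d r => H r d : Finset (ρ → F)) : Set (ρ → F)))
            ht (Submodule.subset_span ?_)
          exact Finset.mem_coe.mpr (Finset.mem_image.mpr ⟨d, by simp [htd], rfl⟩))
    choose c hc hcf using fun t => Finset.mem_image.mp (hf t)
    obtain rfl : (fun t r => H r (c t)) = f := funext hcf
    refine ⟨c, fun s t hst => hli.injective (by simp [hst]), fun i => ?_, hli⟩
    rw [← hfiber i]
    congr 1
    ext t
    simp [(Finset.mem_filter.mp (hc t)).2]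
end

section
/- Let N be a layered linear deterministic network over a finite field with node layers O_1,…,O_M, and let ℓ_1(1),…,ℓ_1(m_1) and ℓ_M(1),…,ℓ_M(m_M) be nonnegative integers with Σ_j ℓ_1(j) = Σ_k ℓ_M(k) = R. Then N supports the rate-R flow d = (ℓ_1(1),…,ℓ_1(m_1); ℓ_M(1),…,ℓ_M(m_M)) if and only if for every cut Ω ⊆ O_1 ∪ ⋯ ∪ O_M one has C(Ω) ≥ Σ_{O_1(j)∈Ω} ℓ_1(j) + Σ_{O_M(k)∉Ω} ℓ_M(k) − R. -/
open Matrix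

section Network

/- A layered linear deterministic network with `M + 1` layers indexed by `Fin (M+1)`, where layer
`i` has `m i` nodes, and for each hop `i : Fin M` a block matrix `G i` whose column blocks are
indexed by the nodes of layer `i.castSucc` and whose row blocks are indexed by the nodes of
layer `i.succ`. -/
variable {F : Type*} [Field F] {M : ℕ} {m : Fin (M + 1) → ℕ}
  {ρ γ : Fin M → Type*}

/-- The capacity `C(Ω) = ∑_i rank (G_i(Ω))` of a cut `Ω`, where `G_i(Ω)` consists of the column
blocks of `G i` indexed by `Ω ∩ O_i` and the row blocks indexed by `O_{i+1} ∖ Ω`. -/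
noncomputable def cutCap [∀ i, Fintype (ρ i)] [∀ i, Fintype (γ i)]
    (G : ∀ i : Fin M, Matrix (ρ i) (γ i) F)
    (rblk : ∀ i : Fin M, ρ i → Fin (m i.succ))
    (cblk : ∀ i : Fin M, γ i → Fin (m i.castSucc))
    (Ω : ∀ i : Fin (M + 1), Finset (Fin (m i))) : ℕ :=
  ∑ i : Fin M, blockRank (G i) (rblk i) (cblk i) ((Ω i.succ)ᶜ) (Ω i.castSucc)

/-- The network supports the rate-`R` flow `(ℓfirst; ℓlast)` if there are per-layer nonnegative
integers `ℓ i`, agreeing with `ℓfirst` on the first layer and with `ℓlast` on the last layer,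
such that every block matrix `G i` supports the flow `(ℓ i.castSucc; ℓ i.succ)` of rate `R`. -/
def NetSupports [∀ i, Fintype (ρ i)] [∀ i, Fintype (γ i)]
    (G : ∀ i : Fin M, Matrix (ρ i) (γ i) F)
    (rblk : ∀ i : Fin M, ρ i → Fin (m i.succ))
    (cblk : ∀ i : Fin M, γ i → Fin (m i.castSucc))
    (ℓfirst : Fin (m 0) → ℕ) (ℓlast : Fin (m (Fin.last M)) → ℕ) (R : ℕ) : Prop :=
  ∃ ℓ : ∀ i : Fin (M + 1), Fin (m i) → ℕ,
    ℓ 0 = ℓfirst ∧ ℓ (Fin.last M) = ℓlast ∧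
    ∀ i : Fin M, SupportsFlow (G i) (rblk i) (cblk i) (ℓ i.castSucc) (ℓ i.succ) R

end Network

section CutSetBound

open Finset Module

theorem exists_discrete_sandwich {α : Type*} [DecidableEq α] (E : Finset α)
    (p q : Finset α → ℤ)
    (hp : ∀ S ⊆ E, ∀ T ⊆ E, p (S ∩ T) + p (S ∪ T) ≤ p S + p T)
    (hq : ∀ S ⊆ E, ∀ T ⊆ E, q S + q T ≤ q (S ∩ T) + q (S ∪ T))
    (hqp : ∀ S ⊆ E, q S ≤ p S) (hq0 : q ∅ = 0) (hp0 : p ∅ = 0) :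
    ∃ x : α → ℤ, ∀ S ⊆ E, q S ≤ ∑ e ∈ S, x e ∧ ∑ e ∈ S, x e ≤ p S := by
  induction E using Finset.induction_on generalizing p q with
  | empty =>
    refine ⟨0, fun S hS => ?_⟩
    rw [subset_empty.1 hS]
    simp [hq0, hp0]
  | insert b E hb ih =>
    have hsub : ∀ S ⊆ E, S ⊆ insert b E := fun S hS => hS.trans (subset_insert b E)
    have hins : ∀ S ⊆ E, insert b S ⊆ insert b E := fun S hS => insert_subset_insert b hS
    have hbS : ∀ S ⊆ E, b ∉ S := fun S hS h => hb (hS h)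
    obtain ⟨t, htl, htu⟩ : ∃ t : ℤ, (∀ W ⊆ E, q (insert b W) - p W ≤ t) ∧
        ∀ V ⊆ E, t ≤ p (insert b V) - q V := by
      obtain ⟨W, hW, hmax⟩ := exists_max_image E.powerset (fun W => q (insert b W) - p W)
        ⟨∅, by simp⟩
      simp only [mem_powerset] at hW hmax
      refine ⟨_, hmax, fun V hV => ?_⟩
      have h1 := hq _ (hins W hW) _ (hsub V hV)
      have h2 := hp _ (hsub W hW) _ (hins V hV)
      rw [insert_inter_of_notMem (hbS V hV), insert_union] at h1
      rw [inter_insert_of_notMem (hbS W hW), union_insert] at h2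
      have h3 := hqp _ (hsub _ (inter_subset_left.trans hW : W ∩ V ⊆ E))
      have h4 := hqp _ (hins _ (union_subset hW hV))
      linarith
    have key (f : Finset α → ℤ)
        (hf : ∀ S ⊆ insert b E, ∀ T ⊆ insert b E, f (S ∩ T) + f (S ∪ T) ≤ f S + f T)
        (s : ℤ) : ∀ S ⊆ E, ∀ T ⊆ E,
        min (f (S ∩ T)) (f (insert b (S ∩ T)) - s) + min (f (S ∪ T)) (f (insert b (S ∪ T)) - s)
          ≤ min (f S) (f (insert b S) - s) + min (f T) (f (insert b T) - s) := by
      intro S hS T hT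
      have h1 := hf _ (hsub S hS) _ (hsub T hT)
      have h2 := hf _ (hins S hS) _ (hsub T hT)
      have h3 := hf _ (hsub S hS) _ (hins T hT)
      have h4 := hf _ (hins S hS) _ (hins T hT)
      rw [insert_inter_of_notMem (hbS T hT), insert_union] at h2
      rw [inter_insert_of_notMem (hbS S hS), union_insert] at h3
      rw [← insert_inter_distrib, ← insert_union_distrib] at h4
      omega
    obtain ⟨x, hx⟩ := ih (fun S => min (p S) (p (insert b S) - t))
      (fun S => -min (-q S) (-q (insert b S) - -t))
      (key p hp t)
      (fun S hS T hT => by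
        have := key (fun S => -q S) (fun S hS T hT => by have := hq S hS T hT; omega) (-t) S hS T hT
        omega)
      (fun S hS => by
        have h1 := hqp _ (hsub S hS)
        have h2 := hqp _ (hins S hS)
        have h3 := htl S hS
        have h4 := htu S hS
        omega)
      (by have h1 := htl ∅ (by simp)
          have h2 := htu ∅ (by simp)
          have h3 := hqp ∅ (by simp)
          omega)
      (by have h1 := htl ∅ (by simp)
          have h2 := htu ∅ (by simp)
          have h3 := hqp ∅ (by simp)
          omega)
    refine ⟨Function.update x b t, fun S hS => ?_⟩
    have hE : S.erase b ⊆ E := by rwa [← subset_insert_iff]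
    have hx' := hx _ hE
    have hsum : ∑ e ∈ S.erase b, Function.update x b t e = ∑ e ∈ S.erase b, x e :=
      sum_congr rfl fun e he => Function.update_of_ne (ne_of_mem_erase he) _ _
    by_cases hbS' : b ∈ S
    · rw [← add_sum_erase _ _ hbS', hsum, Function.update_self]
      simp only [insert_erase hbS'] at hx'
      omega
    · rw [erase_eq_of_notMem hbS'] at hsum hx'
      rw [hsum]
      omega

theorem exists_fiberwise_min_submodular {X β : Type*} [Lattice X] [Finite X] [DecidableEq β]
    (φ : X → Finset β) (hφ : Function.Surjective φ)
    (hinf : ∀ x y, φ (x ⊓ y) = φ x ∩ φ y) (hsup : ∀ x y, φ (x ⊔ y) = φ x ∪ φ y)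
    (h : X → ℤ) (hh : ∀ x y, h (x ⊓ y) + h (x ⊔ y) ≤ h x + h y) :
    ∃ p : Finset β → ℤ, (∀ S T, p (S ∩ T) + p (S ∪ T) ≤ p S + p T) ∧
      (∀ x, p (φ x) ≤ h x) ∧ ∀ S, ∃ x, φ x = S ∧ p S = h x := by
  choose m hm hmin using fun S => (Set.toFinite (φ ⁻¹' {S})).exists_minimalFor h _ (hφ S)
  have hle (x) : h (m (φ x)) ≤ h x := by
    by_contra! hlt
    exact absurd (hmin (φ x) rfl hlt.le) hlt.not_ge
  refine ⟨fun S => h (m S), fun S T => ?_, hle, fun S => ⟨m S, hm S, rfl⟩⟩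
  have hS : φ (m S) = S := hm S
  have hT : φ (m T) = T := hm T
  have h1 := hle (m S ⊓ m T)
  have h2 := hle (m S ⊔ m T)
  rw [hinf, hS, hT] at h1
  rw [hsup, hS, hT] at h2
  have := hh (m S) (m T)
  simp only
  linarith

/-- Rado's theorem for a partition into blocks with prescribed multiplicities. -/
theorem exists_card_le_of_submodular {α β : Type*} [Fintype α] [DecidableEq α] [DecidableEq β]
    [Fintype β] (c : α → β) (d : β → ℕ) (p : Finset α → ℕ)
    (hp : ∀ S T, p (S ∩ T) + p (S ∪ T) ≤ p S + p T) (hmono : Monotone p)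
    (hcard : ∀ S, p S ≤ #S)
    (hd : ∀ J : Finset β, ∑ j ∈ J, d j ≤ p {a | c a ∈ J}) (htot : p univ ≤ ∑ j, d j) :
    ∃ B : Finset α, #B ≤ p B ∧ ∀ j, #{a ∈ B | c a = j} = d j := by
  let full (S : Finset α) : Finset β := {j | ∀ a, c a = j → a ∈ S}
  have hfull {S : Finset α} {j : β} : j ∈ full S ↔ ∀ a, c a = j → a ∈ S := by simp [full]
  have hqp (S : Finset α) : ∑ j ∈ full S, d j ≤ p S :=
    (hd _).trans <| hmono fun a ha => hfull.1 (mem_filter.1 ha).2 a rfl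
  obtain ⟨x, hx⟩ := exists_discrete_sandwich univ (fun S => (p S : ℤ))
    (fun S => ∑ j ∈ full S, (d j : ℤ)) (fun S _ T _ => by exact_mod_cast hp S T)
    (fun S _ T _ => by
      have h1 : full (S ∩ T) = full S ∩ full T := by
        ext j; simp only [hfull, mem_inter]; exact ⟨fun h => ⟨fun a ha => (h a ha).1,
          fun a ha => (h a ha).2⟩, fun h a ha => ⟨h.1 a ha, h.2 a ha⟩⟩
      have h2 : full S ∪ full T ⊆ full (S ∪ T) := by
        intro j; simp only [hfull, mem_union]; exact fun h a ha => h.imp (· a ha) (· a ha)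
      have h3 : ∑ j ∈ full S ∪ full T, (d j : ℤ) ≤ ∑ j ∈ full (S ∪ T), (d j : ℤ) :=
        sum_le_sum_of_subset_of_nonneg h2 fun _ _ _ => by positivity
      have h4 := sum_union_inter (s₁ := full S) (s₂ := full T) (f := fun j => (d j : ℤ))
      simp only [h1]
      linarith)
    (fun S _ => by exact_mod_cast hqp S)
    (by exact_mod_cast Nat.le_zero.1 ((hqp ∅).trans (hcard ∅)))
    (by exact_mod_cast Nat.le_zero.1 (hcard ∅))
  have hnonneg (a) : 0 ≤ x a := by
    have := (hx {a} (subset_univ _)).1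
    rw [sum_singleton] at this
    exact le_trans (by positivity) this
  have hle (a) : x a ≤ 1 := by
    have h1 := (hx {a} (subset_univ _)).2
    have h2 := hcard {a}
    simp only [sum_singleton, card_singleton] at h1 h2
    omega
  have hval (a) : x a = if x a = 1 then 1 else 0 := by
    have := hnonneg a
    have := hle a
    split_ifs <;> omega
  have hsumB (S : Finset α) : ∑ a ∈ S, x a = #{a ∈ S | x a = 1} := by
    rw [sum_congr rfl fun a _ => hval a, sum_boole]
  have hblock (j) : d j ≤ #{a ∈ ({a | x a = 1} : Finset α) | c a = j} := by
    have h1 := (hx ({a | c a = j} : Finset α) (subset_univ _)).1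
    rw [hsumB, filter_comm] at h1
    have h2 : (d j : ℤ) ≤ ∑ i ∈ full {a | c a = j}, (d i : ℤ) :=
      single_le_sum (f := fun i => (d i : ℤ)) (fun _ _ => by positivity) (hfull.2 (by simp))
    exact_mod_cast h2.trans h1
  have htotal : ∑ j, #{a ∈ ({a | x a = 1} : Finset α) | c a = j} ≤ ∑ j, d j := by
    rw [← card_eq_sum_card_fiberwise (fun _ _ => mem_univ _)]
    have h1 := (hx univ (subset_univ _)).2
    rw [hsumB] at h1
    exact le_trans (by exact_mod_cast h1) htot
  refine ⟨({a | x a = 1} : Finset α), ?_, fun j => ?_⟩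
  · have h1 := (hx ({a | x a = 1} : Finset α) (subset_univ _)).2
    rw [hsumB, filter_filter] at h1
    simpa using h1
  · exact ((sum_eq_sum_iff_of_le fun i _ => hblock i).1
      (le_antisymm (sum_le_sum fun i _ => hblock i) htotal) j (mem_univ j)).symm

open Classical in
/-- The dimension of the span of the columns of the augmented matrix `[1 | G]` indexed by `X`. -/
noncomputable def augRank {F ρ γ : Type*} [Field F] (G : Matrix ρ γ F) (X : Finset (ρ ⊕ γ)) : ℕ :=
  finrank F (Submodule.span F ((fromCols 1 G).col '' (X : Set (ρ ⊕ γ))))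

section AugRank

variable {F ρ γ : Type*} [Field F] [Fintype ρ] (G : Matrix ρ γ F)

theorem augRank_mono : Monotone (augRank G) := fun _ _ h =>
  Submodule.finrank_mono (Submodule.span_mono (Set.image_mono (coe_subset.2 h)))

theorem augRank_le_card (X : Finset (ρ ⊕ γ)) : augRank G X ≤ #X := by
  classical
  rw [augRank, ← coe_image]
  exact (finrank_span_finset_le_card _).trans card_image_le

theorem augRank_inter_add_union_le [DecidableEq ρ] [DecidableEq γ] (X Y : Finset (ρ ⊕ γ)) :
    augRank G (X ∩ Y) + augRank G (X ∪ Y) ≤ augRank G X + augRank G Y := by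
  obtain ⟨v, h⟩ : ∃ v : ρ ⊕ γ → ρ → F, ∀ Z : Finset (ρ ⊕ γ),
      augRank G Z = finrank F (Submodule.span F (v '' Z)) := ⟨_, fun _ => rfl⟩
  rw [h X, h Y, ← Submodule.finrank_sup_add_finrank_inf_eq, ← Submodule.span_union,
    ← Set.image_union, ← coe_union, ← h, add_comm]
  gcongr
  rw [h]
  exact Submodule.finrank_mono <| le_inf
    (Submodule.span_mono <| Set.image_mono <| coe_subset.2 inter_subset_left)
    (Submodule.span_mono <| Set.image_mono <| coe_subset.2 inter_subset_right)

theorem augRank_disjSum {I J : Type*} [Fintype J] (S : Finset ρ) (T : Finset γ) (r : I → ρ)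
    (c : J → γ) (hr : Function.Injective r) (hrS : Set.range r = (S : Set ρ)ᶜ)
    (hcT : Set.range c = T) :
    augRank G (S.disjSum T) = #S + (G.submatrix r c).rank := by
  classical
  have : Finite I := Finite.of_injective r hr
  have : Fintype I := Fintype.ofFinite I
  set π := LinearMap.funLeft F F r with hπ
  have hker : LinearMap.ker π = Submodule.span F ((fun i => Pi.single i (1 : F)) '' (S : Set ρ)) := by
    apply le_antisymm
    · intro x hx
      rw [← univ_sum_single x]
      refine Submodule.sum_mem _ fun i _ => ?_
      by_cases hi : i ∈ S
      · rw [← mul_one (x i), ← smul_eq_mul, Pi.single_smul]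
        exact Submodule.smul_mem _ _ (Submodule.subset_span ⟨i, hi, rfl⟩)
      · obtain ⟨k, rfl⟩ : i ∈ Set.range r := by rw [hrS]; exact hi
        have : x (r k) = 0 := congrFun hx k
        simp [this]
    · rw [Submodule.span_le]
      rintro _ ⟨i, hi, rfl⟩
      ext k
      have : r k ≠ i := by
        rintro rfl
        exact (hrS ▸ Set.mem_range_self k : r k ∈ (S : Set ρ)ᶜ) hi
      simp [hπ, LinearMap.funLeft, this]
  have hcardker : finrank F (LinearMap.ker π) = #S := by
    have h1 := LinearMap.finrank_range_add_finrank_ker π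
    rw [LinearMap.range_eq_top.2 (LinearMap.funLeft_surjective_of_injective F F r hr), finrank_top,
      Module.finrank_fintype_fun_eq_card, Module.finrank_fintype_fun_eq_card] at h1
    have h2 : Fintype.card I = Fintype.card ρ - #S := by
      rw [← card_compl, ← card_univ, ← card_image_of_injective _ hr]
      congr 1
      rw [← coe_inj]
      simpa using hrS
    have := card_le_univ S
    omega
  set D := Submodule.span F ((fromCols 1 G).col '' (S.disjSum T : Set (ρ ⊕ γ))) with hD
  have hDsup : D = LinearMap.ker π ⊔ Submodule.span F (Set.range (G.col ∘ c)) := by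
    rw [hker, ← Submodule.span_union, hD, Set.range_comp, hcT]
    congr 1
    ext x
    simp only [Set.mem_image, Set.mem_union, mem_coe, Sum.exists, inl_mem_disjSum, inr_mem_disjSum]
    have h1 (a : ρ) : (fromCols (1 : Matrix ρ ρ F) G).col (Sum.inl a) = Pi.single a 1 := by
      ext i; simp [Matrix.col, Matrix.one_apply, Pi.single_apply]
    have h2 (a : γ) : (fromCols (1 : Matrix ρ ρ F) G).col (Sum.inr a) = G.col a := by
      ext i; simp [Matrix.col]
    simp only [h1, h2]
  have hmap : D.map π = Submodule.span F (Set.range (G.submatrix r c).col) := by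
    rw [hDsup, Submodule.map_sup, Submodule.map_span, ← Set.range_comp,
      (LinearMap.le_ker_iff_map).1 le_rfl, bot_sup_eq]
    rfl
  have hnull := LinearMap.finrank_range_add_finrank_ker (π.domRestrict D)
  have hkD : LinearMap.ker π ≤ D := hDsup ▸ le_sup_left
  rw [LinearMap.range_domRestrict, hmap, LinearMap.ker_domRestrict,
    ← Submodule.finrank_map_subtype_eq, Submodule.map_comap_subtype, inf_eq_right.2 hkD,
    hcardker] at hnull
  rw [rank_eq_finrank_span_cols, augRank, add_comm, hnull]

end AugRank

theorem filter_sumMap_mem_disjSum {ρ γ ι κ : Type*} [DecidableEq ι] [DecidableEq κ]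
    (f : ρ → κ) (g : γ → ι) (S : Finset ρ) (T : Finset γ) (V : Finset κ) (U : Finset ι) :
    {a ∈ S.disjSum T | Sum.map f g a ∈ V.disjSum U} =
      ({i ∈ S | f i ∈ V} : Finset ρ).disjSum {j ∈ T | g j ∈ U} := by
  ext (i | j) <;> simp

section SingleHop

variable {F ρ γ ι κ : Type*} [Field F] [Fintype ρ] [Fintype γ] [DecidableEq ι] [DecidableEq κ]
  (G : Matrix ρ γ F) (rblk : ρ → κ) (cblk : γ → ι)

theorem augRank_filter_mem_disjSum [Fintype κ] (V : Finset κ) (U : Finset ι) :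
    augRank G {a | Sum.map rblk cblk a ∈ V.disjSum U} =
      #{i | rblk i ∈ V} + blockRank G rblk cblk Vᶜ U := by
  rw [← univ_disjSum_univ, filter_sumMap_mem_disjSum]
  refine augRank_disjSum G _ _ _ _ Subtype.val_injective ?_ ?_ <;> ext <;> simp

theorem blockRank_submodular [Fintype κ] (U U' : Finset ι) (V V' : Finset κ) :
    blockRank G rblk cblk (V ∩ V')ᶜ (U ∩ U') + blockRank G rblk cblk (V ∪ V')ᶜ (U ∪ U') ≤
      blockRank G rblk cblk Vᶜ U + blockRank G rblk cblk V'ᶜ U' := by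
  classical
  let X (V : Finset κ) (U : Finset ι) : Finset (ρ ⊕ γ) :=
    {a | Sum.map rblk cblk a ∈ V.disjSum U}
  have hX (V : Finset κ) (U : Finset ι) :
      augRank G (X V U) = #{i | rblk i ∈ V} + blockRank G rblk cblk Vᶜ U :=
    augRank_filter_mem_disjSum G rblk cblk V U
  have h := augRank_inter_add_union_le G (X V U) (X V' U')
  have h1 : X V U ∩ X V' U' = X (V ∩ V') (U ∩ U') := by ext (i | j) <;> simp [X]
  have h2 : X V U ∪ X V' U' = X (V ∪ V') (U ∪ U') := by ext (i | j) <;> simp [X]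
  simp only [h1, h2, hX] at h
  have h3 := card_inter_add_card_union ({i | rblk i ∈ V} : Finset ρ) {i | rblk i ∈ V'}
  rw [← filter_and, ← filter_or] at h3
  simp only [mem_inter, mem_union] at h
  omega

theorem blockRank_empty_right (W : Finset κ) : blockRank G rblk cblk W ∅ = 0 := by
  refine Nat.le_zero.1 ((rank_le_card_width _).trans ?_)
  simp

theorem blockRank_empty_left (U : Finset ι) : blockRank G rblk cblk ∅ U = 0 := by
  refine Nat.le_zero.1 ((rank_le_card_height _).trans ?_)
  simp

theorem blockRank_singleton_le (k : κ) (U : Finset ι) :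
    blockRank G rblk cblk {k} U ≤ #{i | rblk i = k} := by
  refine (rank_le_card_height _).trans ?_
  simp [Fintype.card_subtype]

variable {G rblk cblk} {ℓ : ι → ℕ} {ℓ' : κ → ℕ} {R : ℕ}

theorem SupportsFlow.sum_le [Fintype κ] (h : SupportsFlow G rblk cblk ℓ ℓ' R) (U : Finset ι)
    (V : Finset κ) : ∑ j ∈ U, ℓ j ≤ blockRank G rblk cblk Vᶜ U + ∑ k ∈ V, ℓ' k := by
  classical
  obtain ⟨r, c, hr, hc, hrk, hcj, hu⟩ := h
  set B : Finset (ρ ⊕ γ) := (univ.image r)ᶜ.disjSum (univ.image c) with hB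
  have hcardr : #(univ.image r) = R := by simp [card_image_of_injective _ hr]
  have hBle : #B ≤ augRank G B := by
    rw [hB, augRank_disjSum G _ _ r c hr (by simp) (by simp), rank_of_isUnit _ hu, card_disjSum,
      card_image_of_injective _ hc]
    simp
  set X : Finset (ρ ⊕ γ) := {a | Sum.map rblk cblk a ∈ V.disjSum U} with hX
  have h1 := augRank_inter_add_union_le G (B \ X) (B ∩ X)
  rw [sdiff_union_inter] at h1
  have h2 := augRank_le_card G (B \ X)
  have h3 := augRank_mono G (inter_subset_right : B ∩ X ⊆ X)
  rw [augRank_filter_mem_disjSum] at h3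
  have h4 := card_inter_add_card_sdiff B X
  have h5 : #(B ∩ X) = #{i ∈ (univ.image r)ᶜ | rblk i ∈ V} + #{j ∈ univ.image c | cblk j ∈ U} := by
    rw [← card_disjSum, ← filter_sumMap_mem_disjSum, ← hB]
    congr 1
    ext a
    simp [hX]
  have h6 : #{j ∈ univ.image c | cblk j ∈ U} = ∑ j ∈ U, ℓ j := by
    rw [filter_image, card_image_of_injective _ hc, ← sum_card_fiberwise_eq_card_filter]
    simp [hcj]
  have h7 : #{i ∈ univ.image r | rblk i ∈ V} = ∑ k ∈ V, ℓ' k := by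
    rw [filter_image, card_image_of_injective _ hr, ← sum_card_fiberwise_eq_card_filter]
    simp [hrk]
  have h8 : #{i ∈ (univ.image r)ᶜ | rblk i ∈ V} + #{i ∈ univ.image r | rblk i ∈ V} =
      #{i | rblk i ∈ V} := by
    rw [← card_union_of_disjoint, ← filter_union, union_comm, union_compl]
    exact disjoint_filter_filter disjoint_compl_left
  omega

theorem supportsFlow_of_sum_le [Fintype ι] [Fintype κ] (hℓ : ∑ j, ℓ j = R) (hℓ' : ∑ k, ℓ' k = R)
    (h : ∀ (U : Finset ι) (V : Finset κ),
      ∑ j ∈ U, ℓ j ≤ blockRank G rblk cblk Vᶜ U + ∑ k ∈ V, ℓ' k) :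
    SupportsFlow G rblk cblk ℓ ℓ' R := by
  classical
  have hle (k : κ) : ℓ' k ≤ #{i | rblk i = k} := by
    have h1 := h univ {k}ᶜ
    have h2 := sum_add_sum_compl {k} ℓ'
    have h3 := blockRank_singleton_le G rblk cblk k univ
    rw [compl_compl] at h1
    rw [sum_singleton] at h2
    omega
  have hcard (V : Finset κ) :
      ∑ k ∈ V, (#{i | rblk i = k} - ℓ' k) + ∑ k ∈ V, ℓ' k = #{i | rblk i ∈ V} := by
    rw [← sum_card_fiberwise_eq_card_filter, ← sum_add_distrib]
    exact sum_congr rfl fun k _ => Nat.sub_add_cancel (hle k)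
  have hcardρ := hcard univ
  simp only [mem_univ, filter_true, card_univ] at hcardρ
  obtain ⟨B, hB, hBblk⟩ := exists_card_le_of_submodular (Sum.map rblk cblk)
    (Sum.elim (fun k => #{i | rblk i = k} - ℓ' k) ℓ) (augRank G) (augRank_inter_add_union_le G)
    (augRank_mono G) (augRank_le_card G)
    (fun J => by
      rw [← toLeft_disjSum_toRight (u := J), sum_disjSum, augRank_filter_mem_disjSum]
      have := h J.toRight J.toLeft
      have := hcard J.toLeft
      simp only [Sum.elim_inl, Sum.elim_inr]
      omega)
    (by
      rw [Fintype.sum_sum_type, ← univ_disjSum_univ,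
        augRank_disjSum G univ univ (Empty.elim : Empty → ρ) id
          (Function.injective_of_subsingleton _) (by simp [Set.range_eq_empty]) (by simp)]
      have := rank_le_card_height (G.submatrix (Empty.elim : Empty → ρ) id)
      simp only [Sum.elim_inl, Sum.elim_inr, card_univ, Fintype.card_empty] at this ⊢
      omega)
  obtain ⟨S, T, rfl⟩ : ∃ S T, B = Finset.disjSum S T := ⟨_, _, toLeft_disjSum_toRight.symm⟩
  have hS (k : κ) : #{i ∈ S | rblk i = k} = #{i | rblk i = k} - ℓ' k := by
    rw [← Sum.elim_inl (fun k => #{i | rblk i = k} - ℓ' k) ℓ, ← hBblk,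
      ← card_map Function.Embedding.inl]
    congr 1
    ext (i | j) <;> simp
  have hT (j : ι) : #{i ∈ T | cblk i = j} = ℓ j := by
    rw [← Sum.elim_inr (fun k => #{i | rblk i = k} - ℓ' k) ℓ j, ← hBblk,
      ← card_map Function.Embedding.inr]
    congr 1
    ext (i | j) <;> simp
  have hSc (k : κ) : #{i ∈ Sᶜ | rblk i = k} = ℓ' k := by
    have h1 : #{i ∈ S | rblk i = k} + #{i ∈ Sᶜ | rblk i = k} = #{i | rblk i = k} := by
      rw [← card_union_of_disjoint, ← filter_union, union_compl]
      exact disjoint_filter_filter disjoint_compl_right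
    have := hle k
    have := hS k
    omega
  have hcardS : #Sᶜ = R := by
    rw [card_eq_sum_card_fiberwise (f := rblk) (t := univ) (by simp)]
    simpa [hSc] using hℓ'
  have hcardT : #T = R := by
    rw [card_eq_sum_card_fiberwise (f := cblk) (t := univ) (by simp)]
    simpa [hT] using hℓ
  let r : Fin R → ρ := Sᶜ.equivFinOfCardEq hcardS |>.symm |> (fun e i => (e i : ρ))
  let c : Fin R → γ := T.equivFinOfCardEq hcardT |>.symm |> (fun e i => (e i : γ))
  have hr : Function.Injective r := Subtype.val_injective.comp (Equiv.injective _)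
  have hc : Function.Injective c := Subtype.val_injective.comp (Equiv.injective _)
  have hrange : univ.image r = Sᶜ := by
    rw [← coe_inj, coe_image, coe_univ, Set.image_univ]
    exact ((Equiv.surjective _).range_comp _).trans Subtype.range_coe
  have hcrange : univ.image c = T := by
    rw [← coe_inj, coe_image, coe_univ, Set.image_univ]
    exact ((Equiv.surjective _).range_comp _).trans Subtype.range_coe
  refine ⟨r, c, hr, hc, fun k => ?_, fun j => ?_, ?_⟩
  · rw [← hSc, ← hrange, filter_image, card_image_of_injective _ hr]
  · rw [← hT, ← hcrange, filter_image, card_image_of_injective _ hc]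
  · rw [augRank_disjSum G S T r c hr (by rw [← coe_compl, ← hrange]; simp)
      (by rw [← hcrange]; simp), card_disjSum, hcardT, add_le_add_iff_left] at hB
    rw [← linearIndependent_cols_iff_isUnit, linearIndependent_iff_card_le_finrank_span,
      Set.finrank, ← rank_eq_finrank_span_cols]
    simpa using hB

end SingleHop

theorem sum_add_sum_compl_le_iff {ι κ : Type*} [Fintype κ] [DecidableEq κ] {ℓ : ι → ℕ} {ℓ' : κ → ℕ}
    {R : ℕ} (hℓ' : ∑ k, ℓ' k = R) (U : Finset ι) (V : Finset κ) (C : ℕ) :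
    ∑ j ∈ U, ℓ j + ∑ k ∈ Vᶜ, ℓ' k ≤ C + R ↔ ∑ j ∈ U, ℓ j ≤ C + ∑ k ∈ V, ℓ' k := by
  have := sum_add_sum_compl V ℓ'
  omega

section Cut

variable {F : Type*} [Field F] {M : ℕ}

theorem cutCap_submodular {m : Fin (M + 1) → ℕ} {ρ γ : Fin M → Type*}
    [∀ i, Fintype (ρ i)] [∀ i, Fintype (γ i)] (G : ∀ i : Fin M, Matrix (ρ i) (γ i) F)
    (rblk : ∀ i : Fin M, ρ i → Fin (m i.succ)) (cblk : ∀ i : Fin M, γ i → Fin (m i.castSucc))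
    (Ω Ω' : ∀ i : Fin (M + 1), Finset (Fin (m i))) :
    cutCap G rblk cblk (Ω ⊓ Ω') + cutCap G rblk cblk (Ω ⊔ Ω') ≤
      cutCap G rblk cblk Ω + cutCap G rblk cblk Ω' := by
  simp only [cutCap, ← sum_add_distrib]
  exact sum_le_sum fun i _ => blockRank_submodular (G i) (rblk i) (cblk i) _ _ _ _

theorem cutCap_succ {m : Fin (M + 1 + 1) → ℕ} {ρ γ : Fin (M + 1) → Type*}
    [∀ i, Fintype (ρ i)] [∀ i, Fintype (γ i)] (G : ∀ i : Fin (M + 1), Matrix (ρ i) (γ i) F)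
    (rblk : ∀ i : Fin (M + 1), ρ i → Fin (m i.succ))
    (cblk : ∀ i : Fin (M + 1), γ i → Fin (m i.castSucc))
    (Ω : ∀ i : Fin (M + 1 + 1), Finset (Fin (m i))) :
    cutCap G rblk cblk Ω = blockRank (G 0) (rblk 0) (cblk 0) (Ω (Fin.succ 0))ᶜ (Ω 0) +
      cutCap (m := fun i => m i.succ) (fun i => G i.succ) (fun i => rblk i.succ)
        (fun i => cblk i.succ) (fun i => Ω i.succ) :=
  Fin.sum_univ_succ _

theorem NetSupports.sum_le {m : Fin (M + 1) → ℕ} {ρ γ : Fin M → Type*}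
    [∀ i, Fintype (ρ i)] [∀ i, Fintype (γ i)] {G : ∀ i : Fin M, Matrix (ρ i) (γ i) F}
    {rblk : ∀ i : Fin M, ρ i → Fin (m i.succ)} {cblk : ∀ i : Fin M, γ i → Fin (m i.castSucc)}
    {ℓfirst : Fin (m 0) → ℕ} {ℓlast : Fin (m (Fin.last M)) → ℕ} {R : ℕ}
    (h : NetSupports G rblk cblk ℓfirst ℓlast R) (Ω : ∀ i : Fin (M + 1), Finset (Fin (m i))) :
    ∑ j ∈ Ω 0, ℓfirst j ≤ cutCap G rblk cblk Ω + ∑ k ∈ Ω (Fin.last M), ℓlast k := by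
  obtain ⟨ℓ, rfl, rfl, hℓ⟩ := h
  have h1 := sum_le_sum fun i (_ : i ∈ univ) => (hℓ i).sum_le (Ω i.castSucc) (Ω i.succ)
  rw [sum_add_distrib] at h1
  have h2 := Fin.sum_univ_succ fun i => ∑ j ∈ Ω i, ℓ i j
  rw [Fin.sum_univ_castSucc] at h2
  rw [cutCap]
  omega

/-- An intermediate layer admits integral rates compatible with the hop before it and with the cut
constraint `C` of the network after it. -/
theorem exists_intermediate_rates {ρ γ ι κ X : Type*} [Fintype ρ] [Fintype γ] [Fintype ι]
    [Fintype κ] [DecidableEq ι] [DecidableEq κ] [Lattice X] [BoundedOrder X] [Finite X]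
    (G : Matrix ρ γ F) (rblk : ρ → κ) (cblk : γ → ι) {ℓ : ι → ℕ} {R : ℕ} (hℓ : ∑ j, ℓ j = R)
    (φ : X → Finset κ) (hφ : Function.Surjective φ)
    (hinf : ∀ x y, φ (x ⊓ y) = φ x ∩ φ y) (hsup : ∀ x y, φ (x ⊔ y) = φ x ∪ φ y)
    (C : X → ℕ) (hC : ∀ x y, C (x ⊓ y) + C (x ⊔ y) ≤ C x + C y) (hbot : C ⊥ = 0) (htop : C ⊤ = R)
    (h : ∀ U x, ∑ j ∈ U, ℓ j ≤ blockRank G rblk cblk (φ x)ᶜ U + C x) :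
    ∃ ℓ' : κ → ℕ, ∑ k, ℓ' k = R ∧
      (∀ U V, ∑ j ∈ U, ℓ j ≤ blockRank G rblk cblk Vᶜ U + ∑ k ∈ V, ℓ' k) ∧
      ∀ x, ∑ k ∈ φ x, ℓ' k ≤ C x := by
  have hφbot : φ ⊥ = ∅ := by
    obtain ⟨x, hx⟩ := hφ ∅
    have := hinf x ⊥
    rwa [inf_bot_eq, hx, empty_inter] at this
  have hφtop : φ ⊤ = univ := by
    obtain ⟨x, hx⟩ := hφ univ
    have := hsup x ⊤
    rwa [sup_top_eq, hx, ← sup_eq_union, ← top_eq_univ, top_sup_eq] at this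
  obtain ⟨p, hp, hple, hpeq⟩ := exists_fiberwise_min_submodular φ hφ hinf hsup
    (fun x => (C x : ℤ)) fun x y => by exact_mod_cast hC x y
  obtain ⟨q, hq, hqle, hqeq⟩ := exists_fiberwise_min_submodular
    (Prod.snd : Finset ι × Finset κ → Finset κ) Prod.snd_surjective (fun _ _ => rfl)
    (fun _ _ => rfl) (fun x => (blockRank G rblk cblk x.2ᶜ x.1 : ℤ) - ∑ j ∈ x.1, (ℓ j : ℤ))
    fun x y => by
      have h1 := blockRank_submodular G rblk cblk x.1 y.1 x.2 y.2
      have h2 := sum_union_inter (s₁ := x.1) (s₂ := y.1) (f := fun j => (ℓ j : ℤ))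
      simp only [Prod.fst_inf, Prod.snd_inf, Prod.fst_sup, Prod.snd_sup, inf_eq_inter, sup_eq_union]
      zify at h1
      linarith
  have hqp (V) : -q V ≤ p V := by
    obtain ⟨x, rfl, hx⟩ := hpeq V
    obtain ⟨⟨U, V⟩, rfl, hy⟩ := hqeq (φ x)
    have := h U x
    zify at this
    simp only at hx hy
    linarith
  have hq0 (V) : q V ≤ 0 := by simpa [blockRank_empty_right] using hqle (∅, V)
  have hp0 : p ∅ ≤ 0 := by simpa [hφbot, hbot] using hple ⊥
  have hptop : p univ ≤ R := by simpa [hφtop, htop] using hple ⊤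
  have hqtop : q univ ≤ -R := by
    simpa [blockRank_empty_left, ← Nat.cast_sum, hℓ] using hqle (univ, univ)
  have h00 := hqp ∅
  have hq00 := hq0 ∅
  obtain ⟨x, hx⟩ := exists_discrete_sandwich univ p (fun V => -q V) (fun S _ T _ => hp S T)
    (fun S _ T _ => by linarith [hq S T]) (fun V _ => hqp V) (by linarith) (by linarith)
  lift x to κ → ℕ using fun k => by
    have := (hx {k} (subset_univ _)).1
    rw [sum_singleton] at this
    linarith [hq0 {k}]
  refine ⟨x, ?_, fun U V => ?_, fun y => ?_⟩
  · have := hx univ (subset_univ _)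
    zify
    linarith
  · have h1 := (hx V (subset_univ _)).1
    have h2 := hqle (U, V)
    simp only at h1 h2
    zify
    linarith
  · have h1 := (hx (φ y) (subset_univ _)).2
    zify
    exact h1.trans (hple y)

theorem netSupports_of_sum_le {m : Fin (M + 1) → ℕ} {ρ γ : Fin M → Type*}
    [∀ i, Fintype (ρ i)] [∀ i, Fintype (γ i)] (G : ∀ i : Fin M, Matrix (ρ i) (γ i) F)
    (rblk : ∀ i : Fin M, ρ i → Fin (m i.succ)) (cblk : ∀ i : Fin M, γ i → Fin (m i.castSucc))
    (ℓfirst : Fin (m 0) → ℕ) (ℓlast : Fin (m (Fin.last M)) → ℕ) (R : ℕ)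
    (hfirst : ∑ j, ℓfirst j = R) (hlast : ∑ k, ℓlast k = R)
    (h : ∀ Ω : ∀ i : Fin (M + 1), Finset (Fin (m i)),
      ∑ j ∈ Ω 0, ℓfirst j ≤ cutCap G rblk cblk Ω + ∑ k ∈ Ω (Fin.last M), ℓlast k) :
    NetSupports G rblk cblk ℓfirst ℓlast R := by
  induction M with
  | zero =>
    have hle (j : Fin (m 0)) : ℓfirst j ≤ ℓlast j := by
      have h1 := h (Fin.cons {j} fun i => i.elim0)
      simpa [cutCap] using h1
    have heq : ℓlast = ℓfirst := funext fun j =>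
      ((sum_eq_sum_iff_of_le fun i _ => hle i).1 (hfirst.trans hlast.symm) j (mem_univ j)).symm
    exact ⟨Fin.cons ℓfirst fun i => i.elim0, rfl, heq ▸ rfl, fun i => i.elim0⟩
  | succ M ih =>
    obtain ⟨ℓ', hℓ', hhop, hrest⟩ := exists_intermediate_rates (G 0) (rblk 0) (cblk 0) hfirst
      (fun Ω : ∀ i : Fin (M + 1), Finset (Fin (m i.succ)) => Ω 0)
      (Function.surjective_eval 0) (fun _ _ => rfl) (fun _ _ => rfl)
      (fun Ω => cutCap (m := fun i => m i.succ) (fun i => G i.succ) (fun i => rblk i.succ)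
        (fun i => cblk i.succ) Ω + ∑ k ∈ Ω (Fin.last M), ℓlast k)
      (fun Ω Ω' => by
        have h1 := cutCap_submodular (m := fun i => m i.succ) (fun i => G i.succ)
          (fun i => rblk i.succ) (fun i => cblk i.succ) Ω Ω'
        have h2 := sum_union_inter (s₁ := Ω (Fin.last M)) (s₂ := Ω' (Fin.last M)) (f := ℓlast)
        simp only [Pi.inf_apply, Pi.sup_apply, inf_eq_inter, sup_eq_union]
        omega)
      (by simp [cutCap, blockRank_empty_right])
      (by simpa [cutCap, blockRank_empty_left] using hlast)
      (fun U Ω => by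
        have h1 := h (Fin.cons U Ω)
        rw [cutCap_succ] at h1
        exact h1.trans_eq (add_assoc _ _ _))
    obtain ⟨ℓ, hℓ0, hℓlast, hℓ⟩ := ih (m := fun i => m i.succ) (fun i => G i.succ)
      (fun i => rblk i.succ) (fun i => cblk i.succ) ℓ' ℓlast hℓ' hlast hrest
    refine ⟨Fin.cons ℓfirst ℓ, rfl, hℓlast, fun i => ?_⟩
    cases i using Fin.cases with
    | zero =>
      have := supportsFlow_of_sum_le hfirst hℓ' hhop
      rw [← hℓ0] at this
      exact this
    | succ i => exact hℓ i

end Cut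

end CutSetBound

/-- **Max-flow/min-cut for general flows (Theorem 7 / extension).** A layered linear
deterministic network `N` over a finite field supports the rate-`R` flow
`d = (ℓ₁(1),…,ℓ₁(m₁); ℓ_M(1),…,ℓ_M(m_M))` if and only if for every cut `Ω`,
`C(Ω) ≥ ∑_{O_1(j) ∈ Ω} ℓ₁ j + ∑_{O_M(k) ∉ Ω} ℓ_M k − R`. -/
theorem stmt_3 {F : Type*} [Field F] [Fintype F] {M : ℕ} (hM : 1 ≤ M)
    {m : Fin (M + 1) → ℕ} {ρ γ : Fin M → Type*}
    [∀ i, Fintype (ρ i)] [∀ i, Fintype (γ i)]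
    (G : ∀ i : Fin M, Matrix (ρ i) (γ i) F)
    (rblk : ∀ i : Fin M, ρ i → Fin (m i.succ))
    (cblk : ∀ i : Fin M, γ i → Fin (m i.castSucc))
    (ℓ₁ : Fin (m 0) → ℕ) (ℓM : Fin (m (Fin.last M)) → ℕ) (R : ℕ)
    (h₁ : ∑ j, ℓ₁ j = R) (hM' : ∑ k, ℓM k = R) :
    NetSupports G rblk cblk ℓ₁ ℓM R ↔
      ∀ Ω : ∀ i : Fin (M + 1), Finset (Fin (m i)),
        ∑ j ∈ Ω 0, ℓ₁ j + ∑ k ∈ (Ω (Fin.last M))ᶜ, ℓM k ≤ cutCap G rblk cblk Ω + R := by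
  simp only [sum_add_sum_compl_le_iff hM']
  exact ⟨NetSupports.sum_le, netSupports_of_sum_le G rblk cblk ℓ₁ ℓM R h₁ hM'⟩
end

section
/- Let f_1 and f_2 be nondecreasing, integer-valued, submodular set functions on a finite set V with f_1(∅) = f_2(∅) = 0. Then for each U ⊆ V, max{ Σ_{u∈U} x(u) : x ∈ P_{f_1} ∩ P_{f_2} } = min_{T⊆U} ( f_1(T) + f_2(U∖T) ), and this maximum is attained by a vector x with nonnegative integer coordinates. -/
/-- Membership in the polymatroid `P_f` associated with an integer-valued set function `f` on a
finite set `V` with `f ∅ = 0`: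
`P_f = { x ∈ ℝ^V : x ≥ 0 and ∑_{u∈A} x u ≤ f A for every A ⊆ V }`. -/
def MemPolymatroid {V : Type*} [Fintype V] (f : Finset V → ℤ) (x : V → ℝ) : Prop :=
  (∀ v, 0 ≤ x v) ∧ ∀ A : Finset V, ∑ u ∈ A, x u ≤ (f A : ℝ)

/-- `min_{T ⊆ U} (f₁ T + f₂ (U ∖ T))`. -/
noncomputable def polyMin {V : Type*} [DecidableEq V] (f₁ f₂ : Finset V → ℤ)
    (U : Finset V) : ℤ :=
  U.powerset.inf' ⟨∅, Finset.empty_mem_powerset U⟩ (fun T => f₁ T + f₂ (U \ T))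

section Sandwich

variable {V : Type*} [DecidableEq V]

/-- A set function on finite sets is submodular. -/
def IsSubmodular (f : Finset V → ℤ) : Prop :=
  ∀ A B, f (A ∩ B) + f (A ∪ B) ≤ f A + f B

/-- The set function obtained from `f` by minimising `f S - t * [v ∈ S]` over the sets `S` that
agree with `A` away from `v`. -/
def fiberMin (f : Finset V → ℤ) (v : V) (t : ℤ) (A : Finset V) : ℤ :=
  min (f (A.erase v)) (f (insert v A) - t)

lemma isSubmodular_fiberMin {f : Finset V → ℤ} (hf : IsSubmodular f) (v : V) (t : ℤ) :
    IsSubmodular (fiberMin f v t) := by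
  intro A B
  have h₁ := hf (A.erase v) (B.erase v)
  have h₂ := hf (A.erase v) (insert v B)
  have h₃ := hf (insert v A) (B.erase v)
  have h₄ := hf (insert v A) (insert v B)
  rw [show A.erase v ∩ B.erase v = (A ∩ B).erase v by grind,
    show A.erase v ∪ B.erase v = (A ∪ B).erase v by grind] at h₁
  rw [show A.erase v ∩ insert v B = (A ∩ B).erase v by grind,
    show A.erase v ∪ insert v B = insert v (A ∪ B) by grind] at h₂
  rw [show insert v A ∩ B.erase v = (A ∩ B).erase v by grind,
    show insert v A ∪ B.erase v = insert v (A ∪ B) by grind] at h₃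
  rw [show insert v A ∩ insert v B = insert v (A ∩ B) by grind,
    show insert v A ∪ insert v B = insert v (A ∪ B) by grind] at h₄
  simp only [fiberMin]
  omega

/-- Truncating a nondecreasing submodular function at a constant keeps it submodular. -/
lemma IsSubmodular.min_const {f : Finset V → ℤ} (hf : IsSubmodular f) (hmono : Monotone f)
    (k : ℤ) : IsSubmodular fun A => min (f A) k := by
  intro A B
  have := hf A B
  have := hmono (Finset.inter_subset_left : A ∩ B ⊆ A)
  have := hmono (Finset.inter_subset_right : A ∩ B ⊆ B)
  have := hmono (Finset.subset_union_left : A ⊆ A ∪ B)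
  have := hmono (Finset.subset_union_right : B ⊆ A ∪ B)
  dsimp only
  omega

/-- **Discrete sandwich theorem**, with the supermodular lower bound written as `-h`. -/
theorem exists_sum_le_and_neg_sum_le [Fintype V] (S : Finset V) :
    ∀ {f h : Finset V → ℤ}, IsSubmodular f → IsSubmodular h → f ∅ = 0 → h ∅ = 0 →
      (∀ A, 0 ≤ f A + h A) →
      ∃ m : V → ℤ, ∀ A ⊆ S, ∑ u ∈ A, m u ≤ f A ∧ -∑ u ∈ A, m u ≤ h A := by
  induction S using Finset.induction_on with
  | empty =>
    intro f h _ _ hf0 hh0 _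
    refine ⟨0, fun A hA => ?_⟩
    simp [Finset.subset_empty.mp hA, hf0, hh0]
  | insert v S hv ih =>
    intro f h hf hh hf0 hh0 hfh
    obtain ⟨t, ht₁, ht₂⟩ : ∃ t : ℤ, (∀ A, -h (insert v A) - f (A.erase v) ≤ t) ∧
        ∀ A, t ≤ f (insert v A) + h (A.erase v) := by
      refine ⟨Finset.univ.sup' Finset.univ_nonempty
        fun A => -h (insert v A) - f (A.erase v), fun A => ?_, fun A => ?_⟩
      · exact Finset.le_sup' (fun A => -h (insert v A) - f (A.erase v)) (Finset.mem_univ A)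
      · refine Finset.sup'_le _ _ fun B _ => ?_
        have h₁ := hf (B.erase v) (insert v A)
        have h₂ := hh (A.erase v) (insert v B)
        rw [show B.erase v ∩ insert v A = (A ∩ B).erase v by grind,
          show B.erase v ∪ insert v A = insert v (A ∪ B) by grind] at h₁
        rw [show A.erase v ∩ insert v B = (A ∩ B).erase v by grind,
          show A.erase v ∪ insert v B = insert v (A ∪ B) by grind] at h₂
        linarith [hfh ((A ∩ B).erase v), hfh (insert v (A ∪ B))]
    have hf0' : fiberMin f v t ∅ = 0 := by
      have := ht₂ ∅
      simp only [fiberMin, Finset.erase_empty, hf0, hh0] at this ⊢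
      omega
    have hh0' : fiberMin h v (-t) ∅ = 0 := by
      have := ht₁ ∅
      simp only [fiberMin, Finset.erase_empty, hf0, hh0] at this ⊢
      omega
    obtain ⟨m, hm⟩ := ih (isSubmodular_fiberMin hf v t) (isSubmodular_fiberMin hh v (-t)) hf0' hh0' fun A => by
      have := ht₁ A
      have := ht₂ A
      have := hfh (A.erase v)
      have := hfh (insert v A)
      simp only [fiberMin]
      omega
    refine ⟨Function.update m v t, fun A hA => ?_⟩
    have hsum : ∑ u ∈ A.erase v, Function.update m v t u = ∑ u ∈ A.erase v, m u :=
      Finset.sum_congr rfl fun u hu => Function.update_of_ne (Finset.ne_of_mem_erase hu) _ _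
    obtain ⟨h₁, h₂⟩ := hm (A.erase v) (by grind)
    simp only [fiberMin, Finset.erase_idem] at h₁ h₂
    by_cases hvA : v ∈ A
    · rw [← Finset.add_sum_erase _ _ hvA, hsum, Function.update_self]
      rw [Finset.insert_erase hvA] at h₁ h₂
      omega
    · rw [Finset.erase_eq_of_notMem hvA] at h₁ h₂ hsum
      rw [hsum]
      omega

end Sandwich

section Intersection

variable {V : Type*} [DecidableEq V] {f₁ f₂ : Finset V → ℤ} {U : Finset V}

lemma polyMin_le {T : Finset V} (hT : T ⊆ U) : polyMin f₁ f₂ U ≤ f₁ T + f₂ (U \ T) :=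
  Finset.inf'_le _ (Finset.mem_powerset.mpr hT)

lemma sum_le_polyMin [Fintype V] {x : V → ℝ} (h₁ : MemPolymatroid f₁ x)
    (h₂ : MemPolymatroid f₂ x) : ∑ u ∈ U, x u ≤ (polyMin f₁ f₂ U : ℝ) := by
  obtain ⟨T, hT, hmin⟩ := Finset.exists_mem_eq_inf' ⟨∅, Finset.empty_mem_powerset U⟩
    fun T => f₁ T + f₂ (U \ T)
  rw [polyMin, hmin, ← Finset.sum_sdiff (Finset.mem_powerset.mp hT)]
  push_cast
  linarith [h₁.2 T, h₂.2 (U \ T)]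

lemma memPolymatroid_of_sum_le [Fintype V] {f : Finset V → ℤ} (hmono : Monotone f) {x : V → ℕ}
    (hsupp : ∀ v ∉ U, x v = 0) (hx : ∀ A ⊆ U, ∑ u ∈ A, (x u : ℤ) ≤ f A) :
    MemPolymatroid f fun v => (x v : ℝ) := by
  refine ⟨fun v => Nat.cast_nonneg _, fun A => ?_⟩
  dsimp only
  have hA : ∑ u ∈ A, (x u : ℤ) = ∑ u ∈ A ∩ U, (x u : ℤ) :=
    (Finset.sum_subset Finset.inter_subset_left fun u _ _ => by grind).symm
  have := (hA.trans_le (hx _ Finset.inter_subset_right)).trans (hmono Finset.inter_subset_left)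
  exact_mod_cast this

/-- The integral part of the polymatroid intersection theorem. -/
theorem exists_nat_sum_eq_polyMin [Fintype V] (hsub₁ : IsSubmodular f₁) (hsub₂ : IsSubmodular f₂)
    (hmono₁ : Monotone f₁) (hmono₂ : Monotone f₂) (hempty₁ : f₁ ∅ = 0) (hempty₂ : f₂ ∅ = 0) :
    ∃ x : V → ℕ, MemPolymatroid f₁ (fun v => (x v : ℝ)) ∧
      MemPolymatroid f₂ (fun v => (x v : ℝ)) ∧ (∑ u ∈ U, (x u : ℤ)) = polyMin f₁ f₂ U := by
  have hnn₁ A : 0 ≤ f₁ A := hempty₁ ▸ hmono₁ A.empty_subset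
  have hnn₂ A : 0 ≤ f₂ A := hempty₂ ▸ hmono₂ A.empty_subset
  have hk T : polyMin f₁ f₂ U ≤ f₁ T + f₂ (U \ T) := by
    have := polyMin_le (f₁ := f₁) (f₂ := f₂) (Finset.inter_subset_right : T ∩ U ⊆ U)
    rw [show U \ (T ∩ U) = U \ T by grind] at this
    exact this.trans (by grw [hmono₁ (Finset.inter_subset_left : T ∩ U ⊆ T)])
  have hk0 : 0 ≤ polyMin f₁ f₂ U :=
    Finset.le_inf' _ _ fun T _ => add_nonneg (hnn₁ _) (hnn₂ _)
  have hk₂ : polyMin f₁ f₂ U ≤ f₂ U := by simpa [hempty₁] using hk ∅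
  generalize polyMin f₁ f₂ U = k at hk hk0 hk₂ ⊢
  have hsub : IsSubmodular fun T => min (f₂ (U \ T)) k - k := by
    intro A B
    have := hsub₂.min_const hmono₂ k (U \ A) (U \ B)
    rw [show U \ A ∩ (U \ B) = U \ (A ∪ B) by grind,
      show U \ A ∪ U \ B = U \ (A ∩ B) by grind] at this
    dsimp only at this ⊢
    omega
  obtain ⟨m, hm⟩ := exists_sum_le_and_neg_sum_le U (hsub₁.min_const hmono₁ k) hsub
    (by simp [hempty₁, hk0]) (by simp [hk₂]) fun A => by
      have := hk A
      have := hnn₁ A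
      have := hnn₂ (U \ A)
      omega
  have hm0 : ∀ u ∈ U, 0 ≤ m u := fun u hu => by
    have := (hm {u} (by simpa using hu)).2
    simp only [Finset.sum_singleton] at this
    omega
  have hmU : ∑ u ∈ U, m u = k := by
    have := hm U subset_rfl
    simp only [Finset.sdiff_self, hempty₂] at this
    omega
  have hx : ∀ A ⊆ U, ∑ u ∈ A, ((if u ∈ U then (m u).toNat else 0 : ℕ) : ℤ) = ∑ u ∈ A, m u :=
    fun A hA => Finset.sum_congr rfl fun u hu => by
      rw [if_pos (hA hu), Int.toNat_of_nonneg (hm0 u (hA hu))]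
  refine ⟨fun u => if u ∈ U then (m u).toNat else 0,
    memPolymatroid_of_sum_le hmono₁ (U := U) (fun v hv => if_neg hv) fun A hA => ?_,
    memPolymatroid_of_sum_le hmono₂ (U := U) (fun v hv => if_neg hv) fun A hA => ?_,
    (hx U subset_rfl).trans hmU⟩
  · rw [hx A hA]
    exact (hm A hA).1.trans (min_le_left _ _)
  · rw [hx A hA]
    have h := (hm (U \ A) Finset.sdiff_subset).2
    rw [Finset.sdiff_sdiff_eq_self hA] at h
    have := Finset.sum_sdiff hA (f := m)
    omega

end Intersection

/-- **Edmonds' polymatroid intersection theorem.** Let `f₁` and `f₂` be nondecreasing,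
integer-valued, submodular set functions on a finite set `V` with `f₁ ∅ = f₂ ∅ = 0`.  Then for
each `U ⊆ V`,
`max { ∑_{u∈U} x u : x ∈ P_{f₁} ∩ P_{f₂} } = min_{T ⊆ U} (f₁ T + f₂ (U ∖ T))`,
and this maximum is attained by a vector with nonnegative integer coordinates. -/
theorem stmt_4 {V : Type*} [Fintype V] [DecidableEq V]
    (f₁ f₂ : Finset V → ℤ)
    (hsub₁ : ∀ T₁ T₂, f₁ (T₁ ∩ T₂) + f₁ (T₁ ∪ T₂) ≤ f₁ T₁ + f₁ T₂)
    (hsub₂ : ∀ T₁ T₂, f₂ (T₁ ∩ T₂) + f₂ (T₁ ∪ T₂) ≤ f₂ T₁ + f₂ T₂)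
    (hmono₁ : ∀ T₁ T₂, T₁ ⊆ T₂ → f₁ T₁ ≤ f₁ T₂)
    (hmono₂ : ∀ T₁ T₂, T₁ ⊆ T₂ → f₂ T₁ ≤ f₂ T₂)
    (hempty₁ : f₁ ∅ = 0) (hempty₂ : f₂ ∅ = 0)
    (U : Finset V) :
    IsGreatest {s : ℝ | ∃ x : V → ℝ, MemPolymatroid f₁ x ∧ MemPolymatroid f₂ x ∧
        s = ∑ u ∈ U, x u}
      ((polyMin f₁ f₂ U : ℤ) : ℝ) ∧
    ∃ x : V → ℕ,
      MemPolymatroid f₁ (fun v => (x v : ℝ)) ∧ MemPolymatroid f₂ (fun v => (x v : ℝ)) ∧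
      (∑ u ∈ U, (x u : ℤ)) = polyMin f₁ f₂ U := by
  obtain ⟨x, h₁, h₂, hx⟩ := exists_nat_sum_eq_polyMin (U := U) hsub₁ hsub₂ (fun A B => hmono₁ A B)
    (fun A B => hmono₂ A B) hempty₁ hempty₂
  refine ⟨⟨⟨_, h₁, h₂, ?_⟩, ?_⟩, x, h₁, h₂, hx⟩
  · rw [← hx]
    push_cast
    rfl
  · rintro _ ⟨y, hy₁, hy₂, rfl⟩
    exact sum_le_polyMin hy₁ hy₂
end

section
/- Let F be a field, let G be a matrix over F with column blocks C_1,…,C_m and row blocks R_1,…,R_{m'}, and let d = (ℓ(1),…,ℓ(m); ℓ'(1),…,ℓ'(m')) be a flow vector of rate R such that G satisfies the rank conditions for d. Suppose P = G(W₀,U₀) is tight for d, i.e., rank(P) = Σ_{j∈U₀} ℓ(j) + Σ_{k∈W₀} ℓ'(k) − R. Let G_A be the submatrix of G formed by the rows in the row blocks with indices in W₀ and all columns of G, viewed as a block matrix whose row blocks are {R_k : k ∈ W₀} and whose column blocks are a single distinguished block p consisting of all columns of ∪_{j∈U₀} C_j together with the blocks C_j for j ∉ U₀. Then G_A supports the flow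 d_A = (rank(P), (ℓ(j))_{j∉U₀}; (ℓ'(k))_{k∈W₀}), whose rate is R_A = Σ_{k∈W₀} ℓ'(k) = rank(P) + Σ_{j∉U₀} ℓ(j). -/
open Matrix

section Rado

variable {K V α : Type*} [Field K] [AddCommGroup V] [Module K V] [FiniteDimensional K V]

theorem finrank_image_union_add_le (v : α → V) {X Y Z W : Set α} (hZ : Z ⊆ X ∪ Y)
    (hX : W ⊆ X) (hY : W ⊆ Y) :
    Set.finrank K (v '' Z) + Set.finrank K (v '' W) ≤
      Set.finrank K (v '' X) + Set.finrank K (v '' Y) := by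
  unfold Set.finrank
  rw [← Submodule.finrank_sup_add_finrank_inf_eq (Submodule.span K (v '' X))]
  refine add_le_add (Submodule.finrank_mono ?_) (Submodule.finrank_mono ?_)
  · rw [← Submodule.span_union, ← Set.image_union]
    exact Submodule.span_mono (Set.image_mono hZ)
  · exact le_inf (Submodule.span_mono (Set.image_mono hX))
      (Submodule.span_mono (Set.image_mono hY))

/-- **Rado's theorem** for vectors: a finite family of finite sets of vectors has a linearly
independent transversal if the union of any `n` of the sets spans a space of dimension at
least `n`. -/
theorem exists_linearIndependent_transversal_s7 {ι : Type*} [Fintype ι]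
    (v : α → V) (A : ι → Finset α)
    (hA : ∀ J : Finset ι, J.card ≤ Set.finrank K (v '' ⋃ j ∈ J, (A j : Set α))) :
    ∃ f : ι → α, (∀ i, f i ∈ A i) ∧ LinearIndependent K (v ∘ f) := by
  classical
  induction hn : ∑ i, (A i).card using Nat.strong_induction_on generalizing A with
  | _ n ih =>
  subst hn
  by_cases h1 : ∀ i, (A i).card ≤ 1
  · have hne : ∀ i, (A i).Nonempty := fun i => by
      by_contra h
      have := hA {i}
      simp [Finset.not_nonempty_iff_eq_empty.mp h, Set.finrank] at this
    choose f hf using hne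
    refine ⟨f, hf, linearIndependent_iff_card_le_finrank_span.2 ?_⟩
    refine (hA Finset.univ).trans (Set.finrank_mono ?_)
    rintro _ ⟨a, ha, rfl⟩
    simp only [Set.mem_iUnion, Finset.mem_coe] at ha
    obtain ⟨i, -, hi⟩ := ha
    exact ⟨i, by simp [Finset.card_le_one.1 (h1 i) _ (hf i) _ hi]⟩
  · push Not at h1
    obtain ⟨i, hi⟩ := h1
    obtain ⟨x, hx, y, hy, hxy⟩ := Finset.one_lt_card.1 hi
    have violate : ∀ z ∈ A i,
        (∃ f : ι → α, (∀ i, f i ∈ A i) ∧ LinearIndependent K (v ∘ f)) ∨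
        ∃ J : Finset ι, i ∉ J ∧ Set.finrank K
          (v '' (((A i).erase z : Set α) ∪ ⋃ j ∈ J, (A j : Set α))) ≤ J.card := by
      intro z hz
      by_cases hJ : ∀ J : Finset ι, J.card ≤ Set.finrank K
          (v '' ⋃ j ∈ J, (Function.update A i ((A i).erase z) j : Set α))
      · left
        have hlt : ∑ j, (Function.update A i ((A i).erase z) j).card < ∑ j, (A j).card := by
          refine Finset.sum_lt_sum (fun j _ => ?_) ⟨i, Finset.mem_univ i, ?_⟩
          · rcases eq_or_ne j i with rfl | hj
            · simpa using Finset.card_erase_le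
            · simp [hj]
          · simpa using Finset.card_erase_lt_of_mem hz
        obtain ⟨f, hf, hli⟩ := ih _ hlt _ hJ rfl
        refine ⟨f, fun j => ?_, hli⟩
        have := hf j
        rcases eq_or_ne j i with rfl | hj
        · rw [Function.update_self] at this
          exact Finset.mem_of_mem_erase this
        · simpa [hj] using this
      · right
        push Not at hJ
        obtain ⟨J, hJ⟩ := hJ
        have hset : ∀ L : Finset ι, i ∉ L →
            ⋃ j ∈ L, (Function.update A i ((A i).erase z) j : Set α) =
              ⋃ j ∈ L, (A j : Set α) := fun L hL =>
          Set.iUnion₂_congr fun j hj => by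
            rw [Function.update_of_ne (ne_of_mem_of_not_mem hj hL)]
        have hmem : i ∈ J := by
          by_contra hiJ
          rw [hset J hiJ] at hJ
          exact absurd (hA J) (not_le.2 hJ)
        refine ⟨J.erase i, Finset.notMem_erase i J, ?_⟩
        rw [← Finset.insert_erase hmem, Finset.set_biUnion_insert,
          hset _ (Finset.notMem_erase i J), Function.update_self,
          Finset.card_insert_of_notMem (Finset.notMem_erase i J)] at hJ
        exact Nat.lt_succ_iff.1 hJ
    rcases violate x hx with h | ⟨J₁, hi₁, h₁⟩
    · exact h
    rcases violate y hy with h | ⟨J₂, hi₂, h₂⟩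
    · exact h
    exfalso
    have hsub := finrank_image_union_add_le (K := K) v
      (X := ((A i).erase x : Set α) ∪ ⋃ j ∈ J₁, (A j : Set α))
      (Y := ((A i).erase y : Set α) ∪ ⋃ j ∈ J₂, (A j : Set α))
      (Z := ⋃ j ∈ insert i (J₁ ∪ J₂), (A j : Set α))
      (W := ⋃ j ∈ J₁ ∩ J₂, (A j : Set α))
      (by
        rw [Finset.set_biUnion_insert, Finset.set_biUnion_union]
        rintro a (ha | ha | ha)
        · by_cases hax : a = x
          · exact Or.inr (Or.inl (by simpa [hax, hxy] using hx))
          · exact Or.inl (Or.inl (by simpa [hax] using ha))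
        · exact Or.inl (Or.inr ha)
        · exact Or.inr (Or.inr ha))
      ((Set.biUnion_mono (fun j hj => (Finset.mem_inter.1 hj).1) fun _ _ => subset_rfl).trans
        Set.subset_union_right)
      ((Set.biUnion_mono (fun j hj => (Finset.mem_inter.1 hj).2) fun _ _ => subset_rfl).trans
        Set.subset_union_right)
    have e₁ := hA (insert i (J₁ ∪ J₂))
    have e₂ := hA (J₁ ∩ J₂)
    rw [Finset.card_insert_of_notMem (by simp [hi₁, hi₂])] at e₁
    have := Finset.card_union_add_card_inter J₁ J₂
    omega

/-- Rado's theorem with multiplicities: one can choose `n b` elements from the fibre of `blk` over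
each `b` so that the chosen vectors are linearly independent. -/
theorem exists_linearIndependent_card_fiber {β : Type*} [Fintype α] [Fintype β] [DecidableEq β]
    (v : α → V) (blk : α → β) (n : β → ℕ)
    (h : ∀ J : Finset β, ∑ b ∈ J, n b ≤ Set.finrank K (v '' {a | blk a ∈ J})) :
    ∃ B : Finset α, (∀ b, (B.filter fun a => blk a = b).card = n b) ∧
      LinearIndependent K (fun a : B => v a) := by
  classical
  obtain ⟨f, hf, hli⟩ := exists_linearIndependent_transversal_s7 (K := K) v
    (fun x : Σ b, Fin (n b) => Finset.univ.filter fun a => blk a = x.1) (fun J => by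
      calc J.card ≤ ((J.image Sigma.fst).sigma fun b => (Finset.univ : Finset (Fin (n b)))).card :=
            Finset.card_le_card fun x hx => by
              simp only [Finset.mem_sigma, Finset.mem_univ, and_true]
              exact Finset.mem_image_of_mem _ hx
        _ = ∑ b ∈ J.image Sigma.fst, n b := by simp
        _ ≤ _ := h _
        _ ≤ _ := Set.finrank_mono (Set.image_mono fun a ha => by
          simp only [Finset.mem_image, Set.mem_ofPred_eq] at ha
          obtain ⟨x, hx, hxa⟩ := ha
          simp only [Set.mem_iUnion]
          exact ⟨x, hx, by simp [hxa]⟩))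
  have hinj : Function.Injective f := hli.injective.of_comp
  have hblk : ∀ x, blk (f x) = x.1 := fun x => (Finset.mem_filter.1 (hf x)).2
  refine ⟨Finset.univ.image f, fun b => ?_, ?_⟩
  · have : (Finset.univ.image f).filter (fun a => blk a = b) =
        (Finset.univ : Finset (Fin (n b))).image fun i => f ⟨b, i⟩ := by
      ext a
      simp only [Finset.mem_filter, Finset.mem_image, Finset.mem_univ, true_and]
      constructor
      · rintro ⟨⟨⟨b', i⟩, rfl⟩, hb⟩
        rw [hblk] at hb
        subst hb
        exact ⟨i, rfl⟩
      · rintro ⟨i, rfl⟩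
        exact ⟨⟨_, rfl⟩, hblk _⟩
    rw [this, Finset.card_image_of_injective _ fun _ _ h => sigma_mk_injective (hinj h),
      Finset.card_fin]
  · have hB : ((Finset.univ.image f : Finset α) : Set α) = Set.range f := by simp
    have : LinearIndependent K (fun a : Set.range f => v a) := by
      exact (linearIndependent_equiv' (Equiv.ofInjective f hinj) rfl).1 hli
    rw [← hB] at this
    exact this

end Rado

section Flow

variable {F ρ γ ι κ : Type*} [Field F] [DecidableEq ι] [DecidableEq κ]

theorem SupportsFlow.of_finset [Fintype ι] [Fintype κ] {G : Matrix ρ γ F} {rblk : ρ → κ}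
    {cblk : γ → ι} {ℓ : ι → ℕ} {ℓ' : κ → ℕ} {R : ℕ} (hℓ : ∑ j, ℓ j = R) (hℓ' : ∑ k, ℓ' k = R)
    (T : Finset ρ) (S : Finset γ) (hT : ∀ k, (T.filter fun r => rblk r = k).card = ℓ' k)
    (hS : ∀ j, (S.filter fun c => cblk c = j).card = ℓ j)
    (hli : LinearIndependent F (fun c : S => fun r : T => G r c)) :
    SupportsFlow G rblk cblk ℓ ℓ' R := by
  have hTR : T.card = R := by
    rw [Finset.card_eq_sum_card_fiberwise (f := rblk) (t := Finset.univ) (by simp), ← hℓ']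
    exact Finset.sum_congr rfl fun k _ => hT k
  have hSR : S.card = R := by
    rw [Finset.card_eq_sum_card_fiberwise (f := cblk) (t := Finset.univ) (by simp), ← hℓ]
    exact Finset.sum_congr rfl fun j _ => hS j
  let r := (Finset.equivFinOfCardEq hTR).symm
  let c := (Finset.equivFinOfCardEq hSR).symm
  refine ⟨fun i => r i, fun i => c i, Subtype.val_injective.comp r.injective,
    Subtype.val_injective.comp c.injective, fun k => ?_, fun j => ?_, ?_⟩
  · rw [← hT k]
    refine Finset.card_bij (fun i _ => r i) (by simp) (by simp) fun a ha => ?_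
    rw [Finset.mem_filter] at ha
    exact ⟨r.symm ⟨a, ha.1⟩, by simp [ha.2], by simp⟩
  · rw [← hS j]
    refine Finset.card_bij (fun i _ => c i) (by simp) (by simp) fun a ha => ?_
    rw [Finset.mem_filter] at ha
    exact ⟨c.symm ⟨a, ha.1⟩, by simp [ha.2], by simp⟩
  · rw [← Matrix.linearIndependent_cols_iff_isUnit]
    exact (hli.comp c c.injective).map' (LinearEquiv.funCongrLeft F F r).toLinearMap
      (LinearEquiv.ker _)

variable [Fintype ρ] [Fintype γ]

theorem blockRank_le_card_rows (G : Matrix ρ γ F) (rblk : ρ → κ) (cblk : γ → ι) (W : Finset κ)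
    (U : Finset ι) :
    blockRank G rblk cblk W U ≤ (Finset.univ.filter fun r => rblk r ∈ W).card := by
  rw [← Fintype.card_subtype]
  exact Matrix.rank_le_card_height _

/-- The vectors represented by the columns of the block matrix `[1 | G]`. -/
def augmentedCols [DecidableEq ρ] (G : Matrix ρ γ F) : ρ ⊕ γ → ρ → F :=
  Sum.elim (fun r => Pi.single r 1) G.col

theorem card_add_blockRank_le_finrank [DecidableEq ρ] (G : Matrix ρ γ F) (rblk : ρ → κ)
    (cblk : γ → ι) (W : Finset κ) (U : Finset ι) (X : Set (ρ ⊕ γ))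
    (hXl : ∀ r, rblk r ∉ W → Sum.inl r ∈ X) (hXr : ∀ c, cblk c ∈ U → Sum.inr c ∈ X) :
    (Finset.univ.filter fun r => rblk r ∉ W).card + blockRank G rblk cblk W U ≤
      Set.finrank F (augmentedCols G '' X) := by
  set S := Submodule.span F (augmentedCols G '' X) with hSdef
  let p : S →ₗ[F] ({r // rblk r ∈ W} → F) :=
    (LinearMap.funLeft F F Subtype.val).domRestrict S
  have hmem : ∀ x ∈ X, augmentedCols G x ∈ S := fun x hx =>
    Submodule.subset_span ⟨x, hx, rfl⟩
  have hrange : blockRank G rblk cblk W U ≤ Module.finrank F (LinearMap.range p) := by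
    unfold blockRank
    rw [Matrix.rank_eq_finrank_span_cols]
    refine Submodule.finrank_mono (Submodule.span_le.2 ?_)
    rintro _ ⟨c, rfl⟩
    exact ⟨⟨_, hmem _ (hXr c.1 c.2)⟩, rfl⟩
  have hker : (Finset.univ.filter fun r => rblk r ∉ W).card ≤
      Module.finrank F (LinearMap.ker p) := by
    let e : {r // rblk r ∉ W} → LinearMap.ker p := fun r =>
      ⟨⟨Pi.single r.1 1, hmem _ (hXl r.1 r.2)⟩, by
        ext s
        have : s.1 ≠ r.1 := fun h => r.2 (h ▸ s.2)
        simp [p, LinearMap.funLeft_apply, this]⟩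
    have he : LinearIndependent F e := by
      refine LinearIndependent.of_comp ((S.subtype).comp (LinearMap.ker p).subtype) ?_
      exact (Pi.linearIndependent_single_one ρ F).comp _ Subtype.val_injective
    rw [← Fintype.card_subtype]
    exact he.fintype_card_le_finrank
  have := LinearMap.finrank_range_add_finrank_ker p
  unfold Set.finrank
  rw [← hSdef]
  omega

/-- The rank conditions are sufficient for a block matrix to support a flow. -/
theorem supportsFlow_of_rank_conditions [Fintype ι] [Fintype κ] (G : Matrix ρ γ F)
    (rblk : ρ → κ) (cblk : γ → ι) (ℓ : ι → ℕ) (ℓ' : κ → ℕ) (R : ℕ)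
    (hℓ : ∑ j, ℓ j = R) (hℓ' : ∑ k, ℓ' k = R)
    (hrank : ∀ (U : Finset ι) (W : Finset κ),
      ∑ j ∈ U, ℓ j + ∑ k ∈ W, ℓ' k ≤ blockRank G rblk cblk W U + R) :
    SupportsFlow G rblk cblk ℓ ℓ' R := by
  classical
  have hle : ∀ k, ℓ' k ≤ (Finset.univ.filter fun r => rblk r = k).card := fun k => by
    have h₁ := hrank Finset.univ {k}
    have h₂ := blockRank_le_card_rows G rblk cblk {k} Finset.univ
    simp only [Finset.sum_singleton, Finset.mem_singleton] at h₁ h₂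
    omega
  obtain ⟨B, hBc, hBli⟩ := exists_linearIndependent_card_fiber (K := F) (augmentedCols G)
    (Sum.map rblk cblk)
    (Sum.elim (fun k => (Finset.univ.filter fun r => rblk r = k).card - ℓ' k) ℓ) (fun J => by
      refine le_trans ?_ (card_add_blockRank_le_finrank G rblk cblk J.toLeftᶜ J.toRight _
        (by simp) (by simp))
      have h₁ := hrank J.toRight J.toLeftᶜ
      have h₂ : ∑ k ∈ J.toLeft, ((Finset.univ.filter fun r => rblk r = k).card - ℓ' k) +
          ∑ k ∈ J.toLeft, ℓ' k = (Finset.univ.filter fun r => rblk r ∉ J.toLeftᶜ).card := by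
        rw [← Finset.sum_add_distrib, Finset.card_eq_sum_card_fiberwise (f := rblk)
          (t := J.toLeft) (fun r => by simp)]
        refine Finset.sum_congr rfl fun k hk => ?_
        rw [Nat.sub_add_cancel (hle k), Finset.filter_filter]
        congr 1
        ext r
        simp only [Finset.mem_filter, Finset.mem_univ, true_and, Finset.mem_compl, not_not]
        exact ⟨fun h => ⟨h ▸ hk, h⟩, fun h => h.2⟩
      have h₃ := Finset.sum_add_sum_compl J.toLeft ℓ'
      rw [Finset.sum_sum_eq_sum_toLeft_add_sum_toRight]
      simp only [Sum.elim_inl, Sum.elim_inr]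
      omega)
  refine SupportsFlow.of_finset hℓ hℓ' B.toLeftᶜ B.toRight (fun k => ?_) (fun j => ?_) ?_
  · have h₁ := hBc (Sum.inl k)
    have h₂ : (B.filter fun a => Sum.map rblk cblk a = Sum.inl k).card =
        (B.toLeft.filter fun r => rblk r = k).card := by
      symm
      refine Finset.card_bij (fun r _ => Sum.inl r) (by simp) (by simp) ?_
      rintro (r | c) h <;> simp at h ⊢
      exact h
    have h₃ : (B.toLeftᶜ.filter fun r => rblk r = k).card +
        (B.toLeft.filter fun r => rblk r = k).card =
          (Finset.univ.filter fun r => rblk r = k).card := by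
      rw [← Finset.card_union_of_disjoint
        (Finset.disjoint_filter_filter disjoint_compl_left), ← Finset.filter_union]
      congr 2
      ext r
      simp [or_comm, em]
    have h₄ := hle k
    simp only [Sum.elim_inl] at h₁
    omega
  · have h₁ := hBc (Sum.inr j)
    rw [Sum.elim_inr] at h₁
    rw [← h₁]
    refine Finset.card_bij (fun c _ => Sum.inr c) (by simp) (by simp) ?_
    rintro (r | c) h <;> simp at h ⊢
    exact h
  · rw [Fintype.linearIndependent_iff] at hBli ⊢
    intro g hg
    let y : ρ → F := ∑ c : B.toRight, g c • G.col c
    have hy : ∀ r, r ∉ B.toLeft → y r = 0 := fun r hr => by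
      have := congrFun hg ⟨r, by simpa using hr⟩
      simpa [y] using this
    let g' : ρ ⊕ γ → F :=
      Sum.elim (fun r => - y r) fun c => if hc : c ∈ B.toRight then g ⟨c, hc⟩ else 0
    have key : ∑ a : B, g' a • augmentedCols G a = 0 := by
      rw [Finset.sum_coe_sort B (fun a => g' a • augmentedCols G a),
        Finset.sum_sum_eq_sum_toLeft_add_sum_toRight]
      have h₁ : ∑ r ∈ B.toLeft, g' (Sum.inl r) • augmentedCols G (Sum.inl r) = -y := by
        ext s
        simp only [g', augmentedCols, Sum.elim_inl, Finset.sum_apply, Pi.smul_apply,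
          Pi.single_apply, smul_eq_mul, mul_ite, mul_one, mul_zero, Finset.sum_ite_eq,
          Pi.neg_apply]
        split_ifs with h
        · rfl
        · rw [hy s h, neg_zero]
      have h₂ : ∑ c ∈ B.toRight, g' (Sum.inr c) • augmentedCols G (Sum.inr c) = y := by
        rw [← Finset.sum_coe_sort]
        refine Finset.sum_congr rfl fun c _ => ?_
        simp only [g', augmentedCols, Sum.elim_inr, c.2, dif_pos]
      rw [h₁, h₂, neg_add_cancel]
    intro c
    have := hBli (fun a => g' a) key ⟨Sum.inr c, Finset.mem_toRight.1 c.2⟩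
    simpa only [g', Sum.elim_inr, c.2, dif_pos] using this

theorem blockRank_union_le (G : Matrix ρ γ F) (rblk : ρ → κ) (cblk : γ → ι)
    (W : Finset κ) (U₁ U₂ : Finset ι) :
    blockRank G rblk cblk W (U₁ ∪ U₂) ≤
      blockRank G rblk cblk W U₁ + blockRank G rblk cblk W U₂ := by
  unfold blockRank
  simp only [Matrix.rank_eq_finrank_span_cols]
  refine le_trans (Submodule.finrank_mono ?_) (Submodule.finrank_add_le_finrank_add_finrank _ _)
  rw [Submodule.span_le]
  rintro _ ⟨⟨c, hc⟩, rfl⟩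
  rcases Finset.mem_union.1 hc with h | h
  · exact Submodule.mem_sup_left (Submodule.subset_span ⟨⟨c, h⟩, rfl⟩)
  · exact Submodule.mem_sup_right (Submodule.subset_span ⟨⟨c, h⟩, rfl⟩)

/-- Block ranks are monotone along a pair of maps realising one block submatrix inside another. -/
theorem blockRank_le_blockRank_submatrix {ρ' ι' κ' : Type*} [Fintype ρ'] [DecidableEq ι']
    [DecidableEq κ'] (G : Matrix ρ γ F) (rblk : ρ → κ) (cblk : γ → ι) (f : ρ' → ρ)
    (rblk' : ρ' → κ') (cblk' : γ → ι') {W : Finset κ} {U : Finset ι} {W' : Finset κ'}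
    {U' : Finset ι'} (hW : ∀ r, rblk r ∈ W → ∃ s, f s = r ∧ rblk' s ∈ W')
    (hU : ∀ c, cblk c ∈ U → cblk' c ∈ U') :
    blockRank G rblk cblk W U ≤ blockRank (G.submatrix f id) rblk' cblk' W' U' := by
  choose g hgf hgW using hW
  have h := Matrix.rank_submatrix_le ((G.submatrix f id).submatrix
    (fun r : {r // rblk' r ∈ W'} => r.1) (fun c : {c // cblk' c ∈ U'} => c.1))
    (fun r : {r // rblk r ∈ W} => ⟨g r.1 r.2, hgW r.1 r.2⟩)
    (fun c : {c // cblk c ∈ U} => ⟨c.1, hU c.1 c.2⟩)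
  simpa only [blockRank, Matrix.submatrix_submatrix, Function.comp_def, hgf, id] using h

end Flow

/-- **Lemma 3 (the matrix `G_A` supports the flow `d_A`).** Suppose the block matrix `G`
satisfies the rank conditions for the flow `d = (ℓ; ℓ')` of rate `R`, and `P = G(W₀, U₀)` is
tight for `d`.  Form the matrix `G_A` from the rows of `G` whose row block lies in `W₀` and all
columns of `G`, with row blocks `{R_k : k ∈ W₀}` and column blocks consisting of one
distinguished block `p` (the columns of `∪_{j∈U₀} C_j`, encoded as `none`) together with the
blocks `C_j` for `j ∉ U₀`.  Then `G_A` supports the flow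
`d_A = (rank P, (ℓ j)_{j∉U₀}; (ℓ' k)_{k∈W₀})` of rate `R_A = ∑_{k∈W₀} ℓ' k`. -/
theorem stmt_7 {F : Type*} [Field F] {ρ γ : Type*} [Fintype ρ] [Fintype γ] {m m' : ℕ}
    (G : Matrix ρ γ F) (rblk : ρ → Fin m') (cblk : γ → Fin m)
    (ℓ : Fin m → ℕ) (ℓ' : Fin m' → ℕ) (R : ℕ)
    (hℓ : ∑ j, ℓ j = R) (hℓ' : ∑ k, ℓ' k = R)
    (hrank : ∀ (U : Finset (Fin m)) (W : Finset (Fin m')),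
      ∑ j ∈ U, ℓ j + ∑ k ∈ W, ℓ' k ≤ blockRank G rblk cblk W U + R)
    (U₀ : Finset (Fin m)) (W₀ : Finset (Fin m'))
    (htight : blockRank G rblk cblk W₀ U₀ + R = ∑ j ∈ U₀, ℓ j + ∑ k ∈ W₀, ℓ' k) :
    SupportsFlow
      (fun (r : {r : ρ // rblk r ∈ W₀}) (c : γ) => G r.1 c)
      (fun r => (⟨rblk r.1, r.2⟩ : {k : Fin m' // k ∈ W₀}))
      (fun c => if h : cblk c ∈ U₀ then (none : Option {j : Fin m // j ∉ U₀})
                else some ⟨cblk c, h⟩)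
      (fun j => j.elim (blockRank G rblk cblk W₀ U₀) (fun j' => ℓ j'.1))
      (fun k => ℓ' k.1)
      (∑ k ∈ W₀, ℓ' k) := by
  classical
  have hsub : ∑ k : {k // k ∈ W₀}, ℓ' k.1 = ∑ k ∈ W₀, ℓ' k := Finset.sum_coe_sort W₀ ℓ'
  have hcompl : ∑ j : {j // j ∉ U₀}, ℓ j.1 + ∑ j ∈ U₀, ℓ j = R := by
    rw [← hℓ, ← Finset.sum_compl_add_sum U₀ ℓ, ← Finset.sum_coe_sort U₀ᶜ ℓ]
    congr 1
    exact Fintype.sum_equiv (Equiv.subtypeEquivRight (by simp)) _ _ fun _ => rfl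
  refine supportsFlow_of_rank_conditions (G.submatrix Subtype.val id) _ _ _ _ _ ?_ hsub ?_
  · rw [Fintype.sum_option]
    simp only [Option.elim]
    omega
  intro U W
  set V : Finset (Fin m) := U.eraseNone.map (Function.Embedding.subtype _)
  have hVdisj : Disjoint U₀ V := by
    rw [Finset.disjoint_left]
    intro j hj hjV
    obtain ⟨j', -, rfl⟩ := Finset.mem_map.1 hjV
    exact j'.2 hj
  have hVmem : ∀ j, j ∈ V → ∃ h : j ∉ U₀, some ⟨j, h⟩ ∈ U := by
    intro j hjV
    obtain ⟨j', hj', rfl⟩ := Finset.mem_map.1 hjV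
    exact ⟨j'.2, Finset.mem_eraseNone.1 hj'⟩
  have hVsum : ∑ j ∈ V, ℓ j = ∑ j ∈ U.eraseNone, ℓ j.1 := Finset.sum_map _ _ _
  set X : Finset (Fin m') := W.map (Function.Embedding.subtype _)
  have hXsum : ∑ k ∈ X, ℓ' k = ∑ k ∈ W, ℓ' k.1 := Finset.sum_map _ _ _
  have hXW : ∀ k, k ∈ X → ∃ h : k ∈ W₀, ⟨k, h⟩ ∈ W := by
    intro k hk
    obtain ⟨k', hk', rfl⟩ := Finset.mem_map.1 hk
    exact ⟨k'.2, hk'⟩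
  have hmain := hrank (U₀ ∪ V) X
  rw [Finset.sum_union hVdisj, hVsum, hXsum] at hmain
  have hrows : ∀ r, rblk r ∈ X → ∃ s : {r // rblk r ∈ W₀}, s.1 = r ∧
      (⟨rblk s.1, s.2⟩ : {k // k ∈ W₀}) ∈ W := fun r hr =>
    let ⟨h, hW⟩ := hXW _ hr
    ⟨⟨r, h⟩, rfl, hW⟩
  by_cases hnone : none ∈ U
  · have hU : ∑ j ∈ U, j.elim (blockRank G rblk cblk W₀ U₀) (fun j' => ℓ j'.1) =
        blockRank G rblk cblk W₀ U₀ + ∑ j ∈ U.eraseNone, ℓ j.1 := by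
      rw [← Finset.add_sum_erase U _ hnone, ← Finset.map_some_eraseNone, Finset.sum_map]
      rfl
    have := blockRank_le_blockRank_submatrix G rblk cblk Subtype.val
      (fun r => (⟨rblk r.1, r.2⟩ : {k : Fin m' // k ∈ W₀}))
      (fun c => if h : cblk c ∈ U₀ then (none : Option {j : Fin m // j ∉ U₀})
                else some ⟨cblk c, h⟩) (U := U₀ ∪ V) (U' := U) hrows (fun c hc => by
        split_ifs with h
        · exact hnone
        · exact (hVmem _ ((Finset.mem_union.1 hc).resolve_left h)).2)
    rw [hU]
    omega
  · have hU : ∑ j ∈ U, j.elim (blockRank G rblk cblk W₀ U₀) (fun j' => ℓ j'.1) =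
        ∑ j ∈ U.eraseNone, ℓ j.1 := by
      conv_lhs => rw [← Finset.erase_eq_of_notMem hnone, ← Finset.map_some_eraseNone]
      rw [Finset.sum_map]
      rfl
    have h₁ := blockRank_le_blockRank_submatrix G rblk cblk Subtype.val
      (fun r => (⟨rblk r.1, r.2⟩ : {k : Fin m' // k ∈ W₀}))
      (fun c => if h : cblk c ∈ U₀ then (none : Option {j : Fin m // j ∉ U₀})
                else some ⟨cblk c, h⟩) (U := V) (U' := U) hrows (fun c hc => by
        obtain ⟨h, hc⟩ := hVmem _ hc
        rwa [dif_neg h])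
    have h₂ : blockRank G rblk cblk X U₀ ≤ blockRank G rblk cblk W₀ U₀ :=
      blockRank_le_blockRank_submatrix G rblk cblk id rblk cblk
        (fun r hr => ⟨r, rfl, (hXW _ hr).1⟩) fun _ => id
    have h₃ := blockRank_union_le G rblk cblk X U₀ V
    rw [hU]
    omega
end

section
/- Let F be a field, let G be a matrix over F with column blocks C_1,…,C_m and row blocks R_1,…,R_{m'}, and let d = (ℓ(1),…,ℓ(m); ℓ'(1),…,ℓ'(m')) be a flow vector of rate R such that G satisfies the rank conditions for d. Suppose P = G(W₀,U₀) is tight for d, i.e., rank(P) = Σ_{j∈U₀} ℓ(j) + Σ_{k∈W₀} ℓ'(k) − R. Suppose further that P_c is a submatrix of P consisting of a subset of the rows of P with rank(P_c) = rank(P). Let B be the submatrix of G formed by the rows in the row blocks with indices not in W₀ and the columns in ∪_{j∈U₀} C_j, and let G_B be the matrix obtained by stacking P_c on top of B, viewed as a block matrix whose column blocks are the restrictions of the blocks C_j for j ∈ U₀, and whose row blocks are a single distinguished block consisting of all rows of P_c together with the row blocks R_k for k ∉ W₀ (restricted to these columns). Then G_B supports the flow d_B = ((ℓ(j))_{j∈U₀};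 rank(P), (ℓ'(k))_{k∉W₀}), whose rate is R_B = Σ_{j∈U₀} ℓ(j) = rank(P) + Σ_{k∉W₀} ℓ'(k). -/
open Matrix

open Module Submodule in
/-- **Rado's theorem** for vectors: a finite family of finite sets admits a linearly independent
transversal as soon as the union of any `n` of the sets has rank at least `n`. -/
theorem exists_linearIndependent_transversal_s8 {F V E I : Type*} [Field F] [AddCommGroup V]
    [Module F V] [FiniteDimensional F V] [Fintype I] (v : E → V) (A : I → Finset E)
    (h : ∀ J : Finset I, J.card ≤ finrank F ↥(J.sup fun i => span F (v '' (A i : Set E)))) :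
    ∃ f : I → E, (∀ i, f i ∈ A i) ∧ LinearIndependent F (v ∘ f) := by
  classical
  induction hn : ∑ i, (A i).card using Nat.strong_induction_on generalizing A with
  | _ n ih =>
  set S : I → Submodule F V := fun i => span F (v '' (A i : Set E)) with hS
  by_cases hA : ∀ i, (A i).card ≤ 1
  · have hne : ∀ i, ∃ x, A i = {x} := by
      intro i
      rw [← Finset.card_eq_one]
      refine le_antisymm (hA i) (Nat.one_le_iff_ne_zero.2 fun h0 => ?_)
      have := h {i}
      rw [Finset.card_eq_zero] at h0
      simp [hS, h0] at this
    choose f hf using hne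
    refine ⟨f, fun i => by simp [hf i], ?_⟩
    rw [linearIndependent_iff_card_le_finrank_span]
    refine (h Finset.univ).trans (finrank_mono (Finset.sup_le fun i _ => span_mono ?_))
    rw [hf i]
    simp
  push Not at hA
  obtain ⟨i, hi⟩ := hA
  obtain ⟨x, hx, y, hy, hxy⟩ := Finset.one_lt_card.1 hi
  by_contra hcon
  have key : ∀ z ∈ A i, ∃ J : Finset I, i ∉ J ∧
      finrank F ↥(span F (v '' ((A i).erase z : Set E)) ⊔ J.sup S) ≤ J.card := by
    intro z hz
    by_contra! hall
    apply hcon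
    have hlt : ∑ j, (Function.update A i ((A i).erase z) j).card < n := by
      rw [← hn]
      refine Finset.sum_lt_sum (fun j _ => ?_) ⟨i, Finset.mem_univ i, ?_⟩
      · by_cases hj : j = i
        · subst hj
          simpa using Finset.card_le_card (Finset.erase_subset z (A j))
        · simp [hj]
      · simpa using Finset.card_erase_lt_of_mem hz
    obtain ⟨f, hf, hli⟩ := ih _ hlt (Function.update A i ((A i).erase z)) (fun J => by
      have hcongr : ∀ K : Finset I, i ∉ K →
          (K.sup fun j => span F (v '' (Function.update A i ((A i).erase z) j : Set E)))
            = K.sup S := by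
        intro K hK
        refine Finset.sup_congr rfl fun j hj => ?_
        have : j ≠ i := fun e => hK (e ▸ hj)
        simp [hS, this]
      by_cases hJ : i ∈ J
      · rw [← Finset.insert_erase hJ, Finset.sup_insert, hcongr _ (Finset.notMem_erase i J),
          Finset.card_insert_of_notMem (Finset.notMem_erase i J), Function.update_self]
        exact hall _ (Finset.notMem_erase i J)
      · rw [hcongr _ hJ]
        exact h J) rfl
    refine ⟨f, fun j => ?_, hli⟩
    have := hf j
    by_cases hj : j = i
    · subst hj
      simp only [Function.update_self] at this
      exact Finset.mem_of_mem_erase this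
    · simpa [hj] using this
  obtain ⟨J, hiJ, hJ⟩ := key x hx
  obtain ⟨K, hiK, hK⟩ := key y hy
  have hSi : S i ≤ span F (v '' ((A i).erase x : Set E)) ⊔ span F (v '' ((A i).erase y : Set E)) := by
    rw [← span_union, ← Set.image_union]
    refine span_mono (Set.image_mono fun e he => ?_)
    by_cases hex : e = x
    · right
      subst hex
      simpa [hxy] using he
    · left
      simpa [hex] using he
  have h1 := h (insert i (J ∪ K))
  have h2 := h (J ∩ K)
  rw [Finset.card_insert_of_notMem (by simp [hiJ, hiK])] at h1
  have h3 := finrank_sup_add_finrank_inf_eq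
    (span F (v '' ((A i).erase x : Set E)) ⊔ J.sup S)
    (span F (v '' ((A i).erase y : Set E)) ⊔ K.sup S)
  have h4 := Finset.card_union_add_card_inter J K
  have h5 : finrank F ↥((insert i (J ∪ K)).sup S) ≤
      finrank F ↥((span F (v '' ((A i).erase x : Set E)) ⊔ J.sup S) ⊔
        (span F (v '' ((A i).erase y : Set E)) ⊔ K.sup S)) := by
    refine finrank_mono ?_
    rw [Finset.sup_insert, Finset.sup_union, sup_sup_sup_comm]
    exact sup_le_sup_right hSi _
  have h6 : finrank F ↥((J ∩ K).sup S) ≤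
      finrank F ↥((span F (v '' ((A i).erase x : Set E)) ⊔ J.sup S) ⊓
        (span F (v '' ((A i).erase y : Set E)) ⊔ K.sup S)) :=
    finrank_mono (le_inf
      ((Finset.sup_mono Finset.inter_subset_left).trans le_sup_right)
      ((Finset.sup_mono Finset.inter_subset_right).trans le_sup_right))
  omega

open Module Submodule in
/-- If a subspace of `ρ → F` contains the unit vectors indexed by `X`, then restricting it to
coordinates outside `X` drops the dimension by at least `#X`. -/
theorem finrank_map_funLeft_add_card_le {F ρ α : Type*} [Field F] [Finite ρ] [DecidableEq ρ]
    (S : Submodule F (ρ → F)) (X : Finset ρ) (hX : ∀ r ∈ X, Pi.single r 1 ∈ S)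
    (e : α → ρ) (he : ∀ a, e a ∉ X) :
    finrank F (S.map (LinearMap.funLeft F F e)) + X.card ≤ finrank F S := by
  classical
  rw [← LinearMap.finrank_range_add_finrank_ker ((LinearMap.funLeft F F e).domRestrict S),
    LinearMap.range_domRestrict]
  gcongr
  let u : X → LinearMap.ker ((LinearMap.funLeft F F e).domRestrict S) := fun r =>
    ⟨⟨Pi.single r.1 1, hX _ r.2⟩, by
      ext a
      have : e a ≠ r.1 := fun h => he a (h ▸ r.2)
      simp [LinearMap.funLeft_apply, this]⟩
  have hu : LinearIndependent F u := by
    refine LinearIndependent.of_comp (S.subtype ∘ₗ Submodule.subtype _) ?_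
    have := (Pi.basisFun F ρ).linearIndependent.comp (Subtype.val : X → ρ) Subtype.val_injective
    convert this using 1
    ext r
    simp [u]
  simpa using hu.fintype_card_le_finrank

theorem card_filter_sigma_fst_eq {α : Type*} [Fintype α] [DecidableEq α] (s : α → ℕ) (a : α) :
    (Finset.univ.filter fun x : Σ a, Fin (s a) => x.1 = a).card = s a := by
  have : (Finset.univ.filter fun x : Σ a, Fin (s a) => x.1 = a)
      = ({a} : Finset α).sigma fun a => (Finset.univ : Finset (Fin (s a))) := by
    ext x
    simp
  simp [this, Finset.card_sigma]

open Module Submodule in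
/-- The rank conditions suffice for a block matrix to support a flow. -/
theorem supportsFlow_of_le_blockRank {F : Type*} [Field F] {ρ γ ι κ : Type*} [Fintype ρ]
    [Fintype γ] [Fintype ι] [Fintype κ] [DecidableEq ι] [DecidableEq κ]
    (G : Matrix ρ γ F) (rblk : ρ → κ) (cblk : γ → ι) (ℓ : ι → ℕ) (ℓ' : κ → ℕ) (R : ℕ)
    (hℓ : ∑ j, ℓ j = R) (hℓ' : ∑ k, ℓ' k = R)
    (hrank : ∀ (U : Finset ι) (W : Finset κ),
      ∑ j ∈ U, ℓ j + ∑ k ∈ W, ℓ' k ≤ blockRank G rblk cblk W U + R) :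
    SupportsFlow G rblk cblk ℓ ℓ' R := by
  classical
  set n : κ → ℕ := fun k => (Finset.univ.filter fun r => rblk r = k).card with hn
  have hle : ∀ k, ℓ' k ≤ n k := by
    intro k
    have h1 := hrank Finset.univ {k}
    have h2 : blockRank G rblk cblk {k} Finset.univ ≤ n k := by
      refine (Matrix.rank_le_card_height _).trans ?_
      simp [Fintype.card_subtype, hn]
    simp only [Finset.sum_singleton, hℓ] at h1
    omega
  have hnsum : ∀ W : Finset κ, ∑ k ∈ W, n k = (Finset.univ.filter fun r => rblk r ∈ W).card := by
    intro W
    rw [Finset.card_eq_sum_card_fiberwise (f := rblk) (t := W) (fun r hr => by simpa using hr)]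
    refine Finset.sum_congr rfl fun k hk => ?_
    rw [Finset.filter_filter]
    refine congrArg Finset.card (Finset.ext fun r => ?_)
    simp only [Finset.mem_filter, Finset.mem_univ, true_and]
    exact ⟨fun h => ⟨h ▸ hk, h⟩, fun h => h.2⟩
  let v : ρ ⊕ γ → (ρ → F) := Sum.elim (fun r => Pi.single r 1) (fun c r => G r c)
  let A : (Σ j, Fin (ℓ j)) ⊕ (Σ k, Fin (n k - ℓ' k)) → Finset (ρ ⊕ γ) := Sum.elim
    (fun x => (Finset.univ.filter fun c => cblk c = x.1).map Function.Embedding.inr)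
    (fun x => (Finset.univ.filter fun r => rblk r = x.1).map Function.Embedding.inl)
  obtain ⟨f, hfA, hli⟩ := exists_linearIndependent_transversal_s8 (F := F) v A (fun J => by
    set U : Finset ι := Finset.univ.filter fun j => ∃ x, Sum.inl ⟨j, x⟩ ∈ J with hU
    set W' : Finset κ := Finset.univ.filter fun k => ∃ x, Sum.inr ⟨k, x⟩ ∈ J with hW'
    have hJ : J ⊆ (U.sigma fun j => (Finset.univ : Finset (Fin (ℓ j)))).disjSum
        (W'.sigma fun k => (Finset.univ : Finset (Fin (n k - ℓ' k)))) := by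
      rintro (⟨j, x⟩ | ⟨k, x⟩) hx
      · simpa [hU] using ⟨x, hx⟩
      · simpa [hW'] using ⟨x, hx⟩
    have h1 := Finset.card_le_card hJ
    simp only [Finset.card_disjSum, Finset.card_sigma, Finset.card_univ, Fintype.card_fin] at h1
    have h2 := hrank U W'ᶜ
    have h3 := Finset.sum_add_sum_compl W' ℓ'
    have h4 : ∑ k ∈ W', (n k - ℓ' k) + ∑ k ∈ W', ℓ' k = ∑ k ∈ W', n k := by
      rw [← Finset.sum_add_distrib]
      exact Finset.sum_congr rfl fun k _ => Nat.sub_add_cancel (hle k)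
    rw [hnsum] at h4
    set S := J.sup fun i => span F (v '' (A i : Set (ρ ⊕ γ))) with hS
    have hmem : ∀ i ∈ J, ∀ e ∈ A i, v e ∈ S := fun i hi e he =>
      (Finset.le_sup (f := fun i => span F (v '' (A i : Set (ρ ⊕ γ)))) hi)
        (subset_span ⟨e, he, rfl⟩)
    have h5 := finrank_map_funLeft_add_card_le S (Finset.univ.filter fun r => rblk r ∈ W')
      (fun r hr => by
        simp only [Finset.mem_filter, Finset.mem_univ, true_and, hW'] at hr
        obtain ⟨x, hx⟩ := hr
        exact hmem _ hx (Sum.inl r) (by simp [A]))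
      (fun r : {r : ρ // rblk r ∈ W'ᶜ} => r.1)
      (fun r => by simpa using r.2)
    have h6 : blockRank G rblk cblk W'ᶜ U ≤
        finrank F (S.map (LinearMap.funLeft F F (fun r : {r : ρ // rblk r ∈ W'ᶜ} => r.1))) := by
      rw [blockRank, Matrix.rank_eq_finrank_span_cols]
      refine finrank_mono (span_le.2 ?_)
      rintro _ ⟨c, rfl⟩
      obtain ⟨x, hx⟩ := (Finset.mem_filter.1 c.2).2
      exact ⟨v (Sum.inr c.1), hmem _ hx (Sum.inr c.1) (by simp [A]), rfl⟩
    omega)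
  have hc : ∀ x : Σ j, Fin (ℓ j), ∃ c, cblk c = x.1 ∧ Sum.inr c = f (Sum.inl x) := by
    intro x
    simpa [A] using hfA (Sum.inl x)
  have hg : ∀ x : Σ k, Fin (n k - ℓ' k), ∃ r, rblk r = x.1 ∧ Sum.inl r = f (Sum.inr x) := by
    intro x
    simpa [A] using hfA (Sum.inr x)
  choose c hcb hcf using hc
  choose g hgb hgf using hg
  have hfinj : Function.Injective f := hli.injective.of_comp
  have hcinj : Function.Injective c := fun x y hxy =>
    Sum.inl_injective (hfinj (by rw [← hcf, ← hcf, hxy]))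
  have hginj : Function.Injective g := fun x y hxy =>
    Sum.inr_injective (hfinj (by rw [← hgf, ← hgf, hxy]))
  set T : Finset ρ := (Finset.univ.image g)ᶜ with hT
  have hTk : ∀ k, (T.filter fun r => rblk r = k).card = ℓ' k := by
    intro k
    have h1 : (T.filter fun r => rblk r = k) = (Finset.univ.filter fun r => rblk r = k) \
        ((Finset.univ.filter fun x : Σ k, Fin (n k - ℓ' k) => x.1 = k).image g) := by
      ext r
      simp only [hT, Finset.mem_filter, Finset.mem_compl, Finset.mem_image, Finset.mem_univ,
        true_and, Finset.mem_sdiff]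
      constructor
      · rintro ⟨h, h'⟩
        exact ⟨h', fun ⟨x, _, hx⟩ => h ⟨x, hx⟩⟩
      · rintro ⟨h, h'⟩
        refine ⟨fun ⟨x, hx⟩ => h' ⟨x, ?_, hx⟩, h⟩
        rw [← hgb, hx, h]
    rw [h1, Finset.card_sdiff_of_subset, Finset.card_image_of_injective _ hginj,
      card_filter_sigma_fst_eq (fun k => n k - ℓ' k)]
    · have := hle k
      change n k - (n k - ℓ' k) = ℓ' k
      omega
    · intro r hr
      simp only [Finset.mem_image, Finset.mem_filter, Finset.mem_univ, true_and] at hr ⊢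
      obtain ⟨x, rfl, rfl⟩ := hr
      exact hgb x
  have hTcard : T.card = R := by
    rw [Finset.card_eq_sum_card_fiberwise (f := rblk) (t := Finset.univ) (fun r hr => by simp),
      ← hℓ']
    exact Finset.sum_congr rfl fun k _ => hTk k
  let eT : Fin R ≃ T := (T.equivFinOfCardEq hTcard).symm
  let eC : Fin R ≃ Σ j, Fin (ℓ j) := (Fintype.equivFinOfCardEq (by simp [hℓ])).symm
  refine ⟨fun i => (eT i).1, fun i => c (eC i), Subtype.val_injective.comp eT.injective,
    hcinj.comp eC.injective, fun k => ?_, fun j => ?_, ?_⟩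
  · rw [← hTk k]
    refine Finset.card_bij (fun i _ => (eT i).1) (fun i hi => ?_)
      (fun i _ i' _ h => eT.injective (Subtype.ext h)) (fun r hr => ?_)
    · simpa using hi
    · obtain ⟨h1, h2⟩ := Finset.mem_filter.1 hr
      exact ⟨eT.symm ⟨r, h1⟩, by simpa using h2, by simp⟩
  · rw [← card_filter_sigma_fst_eq ℓ j]
    refine Finset.card_bij (fun i _ => eC i) (fun i hi => ?_)
      (fun i _ i' _ h => eC.injective h) (fun x hx => ?_)
    · simpa [hcb] using hi
    · exact ⟨eC.symm x, by simpa [hcb] using hx, by simp⟩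
  · rw [← Matrix.linearIndependent_cols_iff_isUnit]
    obtain ⟨hl, -, hdisj⟩ := linearIndependent_sum.1 hli
    refine LinearIndependent.map (f := LinearMap.funLeft F F fun i => (eT i).1)
      (v := fun i r => G r (c (eC i))) ?_ ?_
    · convert hl.comp eC eC.injective using 1
      funext i
      simp [v, ← hcf]
    · refine hdisj.mono (span_mono ?_) fun w hw => ?_
      · rintro _ ⟨i, rfl⟩
        exact ⟨eC i, by simp [v, ← hcf]⟩
      · rw [pi_eq_sum_univ' w]
        refine sum_mem fun r _ => ?_
        by_cases hr : r ∈ T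
        · have : w r = 0 := by simpa [LinearMap.funLeft_apply] using congrFun hw (eT.symm ⟨r, hr⟩)
          simp [this]
        · simp only [hT, Finset.mem_compl, Finset.mem_image, Finset.mem_univ, true_and,
            not_not] at hr
          obtain ⟨x, rfl⟩ := hr
          refine smul_mem _ _ (subset_span ⟨x, ?_⟩)
          simp only [Function.comp_apply, ← hgf, v, Sum.elim_inl]

/-- The rank of a submatrix is monotone in its sets of rows and columns. -/
theorem Matrix.rank_submatrix_le_of_range_subset {F ρ γ α α' β β' : Type*} [Field F]
    [Fintype β] [Fintype β'] (G : Matrix ρ γ F) {e : α → ρ} {e' : α' → ρ} {f : β → γ}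
    {f' : β' → γ} (he : Set.range e ⊆ Set.range e') (hf : Set.range f ⊆ Set.range f') :
    (G.submatrix e f).rank ≤ (G.submatrix e' f').rank := by
  choose s hs using fun a => he ⟨a, rfl⟩
  choose t ht using fun b => hf ⟨b, rfl⟩
  obtain rfl : e' ∘ s = e := funext hs
  obtain rfl : f' ∘ t = f := funext ht
  exact (G.submatrix e' f').rank_submatrix_le s t

open Module Submodule in
/-- Subadditivity of the rank under stacking of rows. -/
theorem Matrix.rank_submatrix_sumElim_le {F ρ γ α α' β : Type*} [Field F] [Finite α] [Finite α']
    [Fintype β] (G : Matrix ρ γ F) (e : α → ρ) (e' : α' → ρ) (f : β → γ) :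
    (G.submatrix (Sum.elim e e') f).rank ≤ (G.submatrix e f).rank + (G.submatrix e' f).rank := by
  simp only [Matrix.rank_eq_finrank_span_row]
  refine le_trans (finrank_mono ?_) (Submodule.finrank_add_le_finrank_add_finrank _ _)
  rw [span_le]
  rintro _ ⟨a | a, rfl⟩
  · exact mem_sup_left (subset_span ⟨a, rfl⟩)
  · exact mem_sup_right (subset_span ⟨a, rfl⟩)

open Module Submodule in
/-- Rows of `G` that attain the rank of a larger set of rows may replace that set in any stacked
matrix, also after restricting the columns. -/
theorem Matrix.rank_submatrix_sumElim_le_of_rank_eq {F ρ γ α α' δ β β' : Type*} [Field F]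
    [Finite α] [Finite α'] [Finite δ] [Fintype β] [Fintype β'] (G : Matrix ρ γ F)
    {e : α → ρ} {e' : α' → ρ} (g : δ → ρ) {f : β → γ} {f' : β' → γ}
    (he : Set.range e ⊆ Set.range e') (hf : Set.range f' ⊆ Set.range f)
    (h : (G.submatrix e f).rank = (G.submatrix e' f).rank) :
    (G.submatrix (Sum.elim e' g) f').rank ≤ (G.submatrix (Sum.elim e g) f').rank := by
  choose s hs using fun a => he ⟨a, rfl⟩
  choose t ht using fun b => hf ⟨b, rfl⟩
  obtain rfl : e' ∘ s = e := funext hs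
  obtain rfl : f ∘ t = f' := funext ht
  simp only [Matrix.rank_eq_finrank_span_row] at h ⊢
  have hspan : span F (Set.range (G.submatrix (e' ∘ s) f).row)
      = span F (Set.range (G.submatrix e' f).row) := by
    refine eq_of_le_of_finrank_eq (span_mono ?_) h
    rintro _ ⟨a, rfl⟩
    exact ⟨s a, rfl⟩
  refine finrank_mono (span_le.2 ?_)
  rintro _ ⟨a | a, rfl⟩
  · have h1 : (G.submatrix e' f).row a ∈ span F (Set.range (G.submatrix (e' ∘ s) f).row) :=
      hspan ▸ subset_span ⟨a, rfl⟩
    have h2 := mem_map_of_mem (f := LinearMap.funLeft F F t) h1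
    rw [map_span] at h2
    refine span_mono ?_ h2
    rintro _ ⟨_, ⟨b, rfl⟩, rfl⟩
    exact ⟨Sum.inl b, rfl⟩
  · exact subset_span ⟨Sum.inr a, rfl⟩

/-- **Lemma 4 (the matrix `G_B` supports the flow `d_B`).** Suppose the block matrix `G`
satisfies the rank conditions for the flow `d = (ℓ; ℓ')` of rate `R`, `P = G(W₀, U₀)` is tight
for `d`, and `P_c` is a submatrix of `P` consisting of a subset `Sr` of the rows of `P` with
`rank P_c = rank P`.  Form the matrix `G_B` by stacking `P_c` on top of
`B = G([m'] ∖ W₀, U₀)`: its columns are the columns of `∪_{j∈U₀} C_j` with the inherited column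
blocks, and its row blocks consist of one distinguished block (the rows of `P_c`, encoded as
`none`) together with the row blocks `R_k` for `k ∉ W₀`.  Then `G_B` supports the flow
`d_B = ((ℓ j)_{j∈U₀}; rank P, (ℓ' k)_{k∉W₀})` of rate `R_B = ∑_{j∈U₀} ℓ j`. -/
theorem stmt_8 {F : Type*} [Field F] {ρ γ : Type*} [Fintype ρ] [Fintype γ]
    [DecidableEq ρ] {m m' : ℕ}
    (G : Matrix ρ γ F) (rblk : ρ → Fin m') (cblk : γ → Fin m)
    (ℓ : Fin m → ℕ) (ℓ' : Fin m' → ℕ) (R : ℕ)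
    (hℓ : ∑ j, ℓ j = R) (hℓ' : ∑ k, ℓ' k = R)
    (hrank : ∀ (U : Finset (Fin m)) (W : Finset (Fin m')),
      ∑ j ∈ U, ℓ j + ∑ k ∈ W, ℓ' k ≤ blockRank G rblk cblk W U + R)
    (U₀ : Finset (Fin m)) (W₀ : Finset (Fin m'))
    (htight : blockRank G rblk cblk W₀ U₀ + R = ∑ j ∈ U₀, ℓ j + ∑ k ∈ W₀, ℓ' k)
    (Sr : Finset ρ) (hSr : ∀ r ∈ Sr, rblk r ∈ W₀)
    (hPc : (G.submatrix (fun r : {r : ρ // r ∈ Sr} => r.1)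
        (fun c : {c : γ // cblk c ∈ U₀} => c.1)).rank = blockRank G rblk cblk W₀ U₀) :
    SupportsFlow
      (fun (r : {r : ρ // r ∈ Sr ∨ rblk r ∉ W₀}) (c : {c : γ // cblk c ∈ U₀}) => G r.1 c.1)
      (fun r => if h : rblk r.1 ∈ W₀ then (none : Option {k : Fin m' // k ∉ W₀})
                else some ⟨rblk r.1, h⟩)
      (fun c => (⟨cblk c.1, c.2⟩ : {j : Fin m // j ∈ U₀}))
      (fun j => ℓ j.1)
      (fun k => k.elim (blockRank G rblk cblk W₀ U₀) (fun k' => ℓ' k'.1))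
      (∑ j ∈ U₀, ℓ j) := by
  classical
  have hR' := Finset.sum_add_sum_compl W₀ ℓ'
  have hcompl : ∑ k : {k : Fin m' // k ∉ W₀}, ℓ' k.1 = ∑ k ∈ W₀ᶜ, ℓ' k :=
    (Finset.sum_subtype _ (by simp) _).symm
  refine supportsFlow_of_le_blockRank _ _ _ _ _ _
    (Finset.sum_subtype _ (fun _ => Iff.rfl) _).symm ?_ fun U W => ?_
  · rw [Fintype.sum_option]
    simp only [Option.elim_none, Option.elim_some]
    omega
  set U' : Finset (Fin m) := U.map (Function.Embedding.subtype _) with hU'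
  set V : Finset {k : Fin m' // k ∉ W₀} := Finset.eraseNone W with hV
  set W' : Finset (Fin m') := V.map (Function.Embedding.subtype _) with hW'
  have hUsum : ∑ j ∈ U, ℓ j.1 = ∑ j ∈ U', ℓ j := by simp [hU']
  have hVsum : ∑ k ∈ V, ℓ' k.1 = ∑ k ∈ W', ℓ' k := by simp [hW']
  have hU'U₀ : ∀ j ∈ U', j ∈ U₀ := by
    intro j hj
    obtain ⟨x, -, rfl⟩ := Finset.mem_map.1 hj
    exact x.2
  have hdisj : Disjoint W' W₀ := by
    rw [Finset.disjoint_left]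
    intro k hk
    obtain ⟨x, -, rfl⟩ := Finset.mem_map.1 hk
    exact x.2
  have hmain := hrank U' (W' ∪ W₀)
  rw [Finset.sum_union hdisj] at hmain
  let fU : {c : γ // cblk c ∈ U'} → γ := Subtype.val
  let rW : {r : ρ // rblk r ∈ W'} → ρ := Subtype.val
  let rW₀ : {r : ρ // rblk r ∈ W₀} → ρ := Subtype.val
  let rS : {r : ρ // r ∈ Sr} → ρ := Subtype.val
  have hstack : blockRank G rblk cblk (W' ∪ W₀) U' ≤ (G.submatrix (Sum.elim rW₀ rW) fU).rank := by
    refine G.rank_submatrix_le_of_range_subset ?_ subset_rfl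
    rintro _ ⟨⟨r, hr⟩, rfl⟩
    rcases Finset.mem_union.1 hr with h | h
    · exact ⟨Sum.inr ⟨r, h⟩, rfl⟩
    · exact ⟨Sum.inl ⟨r, h⟩, rfl⟩
  have hcols : ∀ c : {c : γ // cblk c ∈ U'}, ∃ hc : cblk c.1 ∈ U₀,
      (⟨cblk c.1, hc⟩ : {j : Fin m // j ∈ U₀}) ∈ U := by
    intro c
    obtain ⟨x, hx, hxc⟩ := Finset.mem_map.1 c.2
    refine ⟨hU'U₀ _ c.2, ?_⟩
    convert hx
    exact hxc.symm
  have hrows : ∀ r : {r : ρ // rblk r ∈ W'}, ∃ hr : rblk r.1 ∉ W₀,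
      (some ⟨rblk r.1, hr⟩ : Option {k : Fin m' // k ∉ W₀}) ∈ W := by
    intro r
    obtain ⟨x, hx, hxr⟩ := Finset.mem_map.1 r.2
    refine ⟨fun h => Finset.disjoint_left.1 hdisj r.2 h, ?_⟩
    rw [hV, Finset.mem_eraseNone] at hx
    convert hx
    exact hxr.symm
  choose hc hcU using hcols
  choose hr hrW using hrows
  by_cases hnone : none ∈ W
  · have hWsum : ∑ k ∈ W, k.elim (blockRank G rblk cblk W₀ U₀) (fun k' => ℓ' k'.1)
        = blockRank G rblk cblk W₀ U₀ + ∑ k ∈ V, ℓ' k.1 := by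
      have : W = Finset.insertNone V := by simp [hV, Finset.insert_eq_of_mem hnone]
      rw [this, Finset.sum_insertNone]
      rfl
    have hrep : (G.submatrix (Sum.elim rW₀ rW) fU).rank
        ≤ (G.submatrix (Sum.elim rS rW) fU).rank := by
      refine G.rank_submatrix_sumElim_le_of_rank_eq
        (f := fun c : {c : γ // cblk c ∈ U₀} => c.1) rW ?_ ?_ hPc
      · rintro _ ⟨r, rfl⟩
        exact ⟨⟨r.1, hSr _ r.2⟩, rfl⟩
      · rintro _ ⟨c, rfl⟩
        exact ⟨⟨c.1, hc c⟩, rfl⟩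
    have hsub := Matrix.rank_submatrix_le_of_range_subset G
      (e := Sum.elim rS rW) (f := fU)
      (e' := fun r : {r : {r : ρ // r ∈ Sr ∨ rblk r ∉ W₀} //
        (if h : rblk r.1 ∈ W₀ then (none : Option {k : Fin m' // k ∉ W₀})
          else some ⟨rblk r.1, h⟩) ∈ W} => r.1.1)
      (f' := fun c : {c : {c : γ // cblk c ∈ U₀} //
        (⟨cblk c.1, c.2⟩ : {j : Fin m // j ∈ U₀}) ∈ U} => c.1.1)
      (by
        rintro _ ⟨r | r, rfl⟩
        · exact ⟨⟨⟨r.1, Or.inl r.2⟩, by simpa [hSr _ r.2] using hnone⟩, rfl⟩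
        · exact ⟨⟨⟨r.1, Or.inr (hr r)⟩, by simpa [hr r] using hrW r⟩, rfl⟩)
      (by
        rintro _ ⟨c, rfl⟩
        exact ⟨⟨⟨c.1, hc c⟩, hcU c⟩, rfl⟩)
    rw [hWsum, hUsum, hVsum, blockRank.eq_def (fun _ _ => _)]
    refine le_trans ?_ (Nat.add_le_add_right hsub _)
    omega
  · have hWsum : ∑ k ∈ W, k.elim (blockRank G rblk cblk W₀ U₀) (fun k' => ℓ' k'.1)
        = ∑ k ∈ V, ℓ' k.1 := by
      have : W = V.map Function.Embedding.some := by
        simp [hV, Finset.erase_eq_of_notMem hnone]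
      rw [this, Finset.sum_map]
      rfl
    have hadd := G.rank_submatrix_sumElim_le rW₀ rW fU
    have hP : (G.submatrix rW₀ fU).rank ≤ blockRank G rblk cblk W₀ U₀ := by
      refine G.rank_submatrix_le_of_range_subset subset_rfl ?_
      rintro _ ⟨c, rfl⟩
      exact ⟨⟨c.1, hc c⟩, rfl⟩
    have hsub := Matrix.rank_submatrix_le_of_range_subset G
      (e := rW) (f := fU)
      (e' := fun r : {r : {r : ρ // r ∈ Sr ∨ rblk r ∉ W₀} //
        (if h : rblk r.1 ∈ W₀ then (none : Option {k : Fin m' // k ∉ W₀})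
          else some ⟨rblk r.1, h⟩) ∈ W} => r.1.1)
      (f' := fun c : {c : {c : γ // cblk c ∈ U₀} //
        (⟨cblk c.1, c.2⟩ : {j : Fin m // j ∈ U₀}) ∈ U} => c.1.1)
      (by
        rintro _ ⟨r, rfl⟩
        exact ⟨⟨⟨r.1, Or.inr (hr r)⟩, by simpa [hr r] using hrW r⟩, rfl⟩)
      (by
        rintro _ ⟨c, rfl⟩
        exact ⟨⟨⟨c.1, hc c⟩, hcU c⟩, rfl⟩)
    rw [hWsum, hUsum, hVsum, blockRank.eq_def (fun _ _ => _)]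
    refine le_trans ?_ (Nat.add_le_add_right hsub _)
    omega
end

section
/- Let G be a matrix over a field whose column blocks are indexed by a finite set X and whose row blocks are indexed by a finite set Y. For Ω ⊆ X ∪ Y, let G(Ω) denote the submatrix of G consisting of the column blocks indexed by Ω ∩ X and the row blocks indexed by Y ∖ Ω. Then the function Ω ↦ rank(G(Ω)) is submodular: for all Ω_1, Ω_2 ⊆ X ∪ Y, rank(G(Ω_1)) + rank(G(Ω_2)) ≥ rank(G(Ω_1 ∩ Ω_2)) + rank(G(Ω_1 ∪ Ω_2)). -/
open Matrix

/-- For a matrix `G` whose column blocks are indexed by `X` (via `cblk`) and whose row blocks are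
indexed by `Y` (via `rblk`), and a subset `Ω ⊆ X ∪ Y` (modeled as `Finset (X ⊕ Y)`), `cutRank`
is the rank of the submatrix `G(Ω)` consisting of the column blocks indexed by `Ω ∩ X` and the
row blocks indexed by `Y ∖ Ω`. -/
noncomputable def cutRank {F : Type*} [Field F] {ρ γ X Y : Type*} [Fintype ρ] [Fintype γ]
    [DecidableEq X] [DecidableEq Y]
    (G : Matrix ρ γ F) (rblk : ρ → Y) (cblk : γ → X) (Ω : Finset (X ⊕ Y)) : ℕ :=
  (G.submatrix (fun r : {r : ρ // Sum.inr (rblk r) ∉ Ω} => r.1)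
               (fun c : {c : γ // Sum.inl (cblk c) ∈ Ω} => c.1)).rank

/-- The vectors in `ρ → F` supported on `s`. -/
def supportedOn (F : Type*) [Field F] {ρ : Type*} (s : Set ρ) : Submodule F (ρ → F) where
  carrier := {v | ∀ r ∉ s, v r = 0}
  zero_mem' := fun _ _ => rfl
  add_mem' := fun hv hw r hr => by simp [hv r hr, hw r hr]
  smul_mem' := fun c v hv r hr => by simp [hv r hr]

theorem mem_supportedOn {F : Type*} [Field F] {ρ : Type*} {s : Set ρ} {v : ρ → F} :
    v ∈ supportedOn F s ↔ ∀ r ∉ s, v r = 0 := Iff.rfl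

theorem supportedOn_inter (F : Type*) [Field F] {ρ : Type*} (s t : Set ρ) :
    supportedOn F (s ∩ t) = supportedOn F s ⊓ supportedOn F t := by
  ext v
  simp only [Submodule.mem_inf, mem_supportedOn, Set.mem_inter_iff]
  grind

theorem supportedOn_union (F : Type*) [Field F] {ρ : Type*} (s t : Set ρ) :
    supportedOn F (s ∪ t) = supportedOn F s ⊔ supportedOn F t := by
  apply le_antisymm
  · intro v hv
    rw [← Set.indicator_self_add_compl s v]
    refine Submodule.add_mem_sup (fun r hr => Set.indicator_of_notMem hr v) fun r hr => ?_
    by_cases hs : r ∈ s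
    · exact Set.indicator_of_notMem (by simpa using hs) v
    · rw [Set.indicator_of_mem (by simpa using hs)]
      exact hv r (by simp [hs, hr])
  · exact sup_le (fun v hv r hr => hv r fun h => hr (Or.inl h))
      fun v hv r hr => hv r fun h => hr (Or.inr h)

theorem ker_funLeft_subtype_val (F : Type*) [Field F] {ρ : Type*} (s : Set ρ) :
    LinearMap.ker (LinearMap.funLeft F F (Subtype.val : {r // r ∉ s} → ρ)) = supportedOn F s := by
  ext v
  simp [mem_supportedOn, funext_iff, LinearMap.funLeft_apply]

/-- Deleting the rows in `s` amounts to passing to the quotient by the vectors supported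
on `s`. -/
theorem rank_submatrix_add_finrank_supportedOn {F : Type*} [Field F] {ρ γ : Type*} [Fintype ρ]
    [Fintype γ] (G : Matrix ρ γ F) (s : Set ρ) (t : Set γ) [Fintype {c // c ∈ t}] :
    (G.submatrix (fun r : {r // r ∉ s} => r.1) (fun c : {c // c ∈ t} => c.1)).rank +
        Module.finrank F (supportedOn F s) =
      Module.finrank F ↥(Submodule.span F (G.col '' t) ⊔ supportedOn F s) := by
  set f := LinearMap.funLeft F F (Subtype.val : {r // r ∉ s} → ρ)
  set U := Submodule.span F (G.col '' t) ⊔ supportedOn F s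
  have hker : LinearMap.ker f = supportedOn F s := ker_funLeft_subtype_val F s
  have hmap : U.map f = Submodule.span F (Set.range
      (G.submatrix (fun r : {r // r ∉ s} => r.1) (fun c : {c // c ∈ t} => c.1)).col) := by
    rw [Submodule.map_sup, LinearMap.le_ker_iff_map.1 hker.ge, sup_bot_eq, Submodule.map_span,
      Set.image_image, Set.image_eq_range]
    rfl
  rw [Matrix.rank_eq_finrank_span_cols, ← hmap, ← hker,
    ← LinearMap.finrank_range_add_finrank_ker (f.domRestrict U), LinearMap.range_domRestrict,
    LinearMap.ker_domRestrict]
  congr 1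
  exact (Submodule.comapSubtypeEquivOfLe (hker.le.trans le_sup_right)).finrank_eq.symm

/-- `cutRank` in terms of the rows and columns whose blocks lie in `Ω`. -/
theorem cutRank_add_finrank_supportedOn {F : Type*} [Field F] {ρ γ X Y : Type*} [Fintype ρ]
    [Fintype γ] [DecidableEq X] [DecidableEq Y] (G : Matrix ρ γ F) (rblk : ρ → Y) (cblk : γ → X)
    (Ω : Finset (X ⊕ Y)) {s : Set ρ} {t : Set γ} (hs : {r | Sum.inr (rblk r) ∈ Ω} = s)
    (ht : {c | Sum.inl (cblk c) ∈ Ω} = t) :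
    cutRank G rblk cblk Ω + Module.finrank F (supportedOn F s) =
      Module.finrank F ↥(Submodule.span F (G.col '' t) ⊔ supportedOn F s) := by
  subst hs ht
  let : Fintype {c // c ∈ {c | Sum.inl (cblk c) ∈ Ω}} :=
    inferInstanceAs (Fintype {c // Sum.inl (cblk c) ∈ Ω})
  exact rank_submatrix_add_finrank_supportedOn G {r | Sum.inr (rblk r) ∈ Ω}
    {c | Sum.inl (cblk c) ∈ Ω}

/-- **Lemma 9 (submodularity of the cut rank).** Let `G` be a matrix over a field whose column
blocks are indexed by a finite set `X` and whose row blocks are indexed by a finite set `Y`.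
For `Ω ⊆ X ∪ Y` let `G(Ω)` be the submatrix consisting of the column blocks indexed by `Ω ∩ X`
and the row blocks indexed by `Y ∖ Ω`.  Then `Ω ↦ rank (G(Ω))` is submodular:
`rank G(Ω₁) + rank G(Ω₂) ≥ rank G(Ω₁ ∩ Ω₂) + rank G(Ω₁ ∪ Ω₂)`. -/
theorem stmt_9 {F : Type*} [Field F] {ρ γ X Y : Type*} [Fintype ρ] [Fintype γ]
    [Fintype X] [Fintype Y] [DecidableEq X] [DecidableEq Y]
    (G : Matrix ρ γ F) (rblk : ρ → Y) (cblk : γ → X)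
    (Ω₁ Ω₂ : Finset (X ⊕ Y)) :
    cutRank G rblk cblk (Ω₁ ∩ Ω₂) + cutRank G rblk cblk (Ω₁ ∪ Ω₂) ≤
      cutRank G rblk cblk Ω₁ + cutRank G rblk cblk Ω₂ := by
  set s₁ : Set ρ := {r | Sum.inr (rblk r) ∈ Ω₁} with hs₁
  set s₂ : Set ρ := {r | Sum.inr (rblk r) ∈ Ω₂} with hs₂
  set t₁ : Set γ := {c | Sum.inl (cblk c) ∈ Ω₁} with ht₁
  set t₂ : Set γ := {c | Sum.inl (cblk c) ∈ Ω₂} with ht₂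
  have h₁ := cutRank_add_finrank_supportedOn G rblk cblk Ω₁ hs₁.symm ht₁.symm
  have h₂ := cutRank_add_finrank_supportedOn G rblk cblk Ω₂ hs₂.symm ht₂.symm
  have hi := cutRank_add_finrank_supportedOn G rblk cblk (Ω₁ ∩ Ω₂)
    (s := s₁ ∩ s₂) (t := t₁ ∩ t₂) (by ext; simp [s₁, s₂]) (by ext; simp [t₁, t₂])
  have hu := cutRank_add_finrank_supportedOn G rblk cblk (Ω₁ ∪ Ω₂)
    (s := s₁ ∪ s₂) (t := t₁ ∪ t₂) (by ext; simp [s₁, s₂]) (by ext; simp [t₁, t₂])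
  have hs := Submodule.finrank_sup_add_finrank_inf_eq (supportedOn F s₁) (supportedOn F s₂)
  have hU := Submodule.finrank_sup_add_finrank_inf_eq
    (Submodule.span F (G.col '' t₁) ⊔ supportedOn F s₁)
    (Submodule.span F (G.col '' t₂) ⊔ supportedOn F s₂)
  have hle : Submodule.span F (G.col '' (t₁ ∩ t₂)) ⊔ supportedOn F (s₁ ∩ s₂) ≤
      (Submodule.span F (G.col '' t₁) ⊔ supportedOn F s₁) ⊓
        (Submodule.span F (G.col '' t₂) ⊔ supportedOn F s₂) := by
    rw [supportedOn_inter]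
    refine le_inf (sup_le_sup (Submodule.span_mono ?_) inf_le_left)
      (sup_le_sup (Submodule.span_mono ?_) inf_le_right)
    · exact Set.image_mono Set.inter_subset_left
    · exact Set.image_mono Set.inter_subset_right
  have hfin := Submodule.finrank_mono hle
  rw [← supportedOn_union, ← supportedOn_inter] at hs
  rw [Set.image_union, Submodule.span_union, supportedOn_union, sup_sup_sup_comm,
    ← supportedOn_union] at hu
  omega
end

section
/- Let M be a matrix over a field with row index set P and column index set Q, and let P_1 ⊆ P and Q_1 ⊆ Q. Denote by M[P', Q'] the submatrix of M on rows P' and columns Q'. Then rank(M) + rank(M[P_1, Q_1]) ≥ rank(M[P_1, Q]) + rank(M[P, Q_1]). -/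
open Matrix

/-- A linear map loses at least as much dimension on a subspace as on a smaller one. -/
theorem Submodule.finrank_map_add_finrank_le_of_le {F V V' : Type*} [Field F]
    [AddCommGroup V] [Module F V] [FiniteDimensional F V] [AddCommGroup V'] [Module F V']
    (f : V →ₗ[F] V') {S T : Submodule F V} (h : S ≤ T) :
    Module.finrank F (T.map f) + Module.finrank F S ≤
      Module.finrank F T + Module.finrank F (S.map f) := by
  have hS := (f.domRestrict S).finrank_range_add_finrank_ker
  have hT := (f.domRestrict T).finrank_range_add_finrank_ker
  rw [LinearMap.range_domRestrict] at hS hT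
  have hker : Module.finrank F (LinearMap.ker (f.domRestrict S)) ≤
      Module.finrank F (LinearMap.ker (f.domRestrict T)) := by
    rw [← LinearEquiv.finrank_eq ((LinearMap.ker (f.domRestrict S)).equivMapOfInjective
      (Submodule.inclusion h) (Submodule.inclusion_injective h)).symm]
    refine Submodule.finrank_mono ?_
    rintro _ ⟨x, hx, rfl⟩
    simpa using hx
  omega

/-- The rank of a matrix restricted to some rows is the dimension of the image of its column space
under the coordinate restriction. -/
theorem Matrix.rank_submatrix_rows {F P P' Q : Type*} [Field F] [Fintype Q]
    (A : Matrix P Q F) (r : P' → P) :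
    (A.submatrix r id).rank =
      Module.finrank F ((Submodule.span F (Set.range A.col)).map (LinearMap.funLeft F F r)) := by
  rw [rank_eq_finrank_span_cols, Submodule.map_span, ← Set.range_comp]
  rfl

/-- **Submodularity of the rank of submatrices.** Let `M` be a matrix over a field with row index
set `P` and column index set `Q`, and let `P₁ ⊆ P` and `Q₁ ⊆ Q`.  Then
`rank M + rank M[P₁, Q₁] ≥ rank M[P₁, Q] + rank M[P, Q₁]`. -/
theorem stmt_10 {F : Type*} [Field F] {P Q : Type*} [Fintype P] [Fintype Q]
    [DecidableEq P] [DecidableEq Q]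
    (M : Matrix P Q F) (P₁ : Finset P) (Q₁ : Finset Q) :
    (M.submatrix (fun r : {r : P // r ∈ P₁} => r.1) (id : Q → Q)).rank +
        (M.submatrix (id : P → P) (fun c : {c : Q // c ∈ Q₁} => c.1)).rank ≤
      M.rank + (M.submatrix (fun r : {r : P // r ∈ P₁} => r.1)
        (fun c : {c : Q // c ∈ Q₁} => c.1)).rank := by
  have hle : Submodule.span F (Set.range (M.submatrix (id : P → P)
      (fun c : {c : Q // c ∈ Q₁} => c.1)).col) ≤ Submodule.span F (Set.range M.col) := by
    refine Submodule.span_mono ?_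
    rintro _ ⟨c, rfl⟩
    exact ⟨c.1, rfl⟩
  have key := Submodule.finrank_map_add_finrank_le_of_le
    (LinearMap.funLeft F F (fun r : {r : P // r ∈ P₁} => r.1)) hle
  rwa [← Matrix.rank_submatrix_rows, ← Matrix.rank_submatrix_rows,
    ← rank_eq_finrank_span_cols, ← rank_eq_finrank_span_cols] at key
end
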